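/- (Convergence of RK collocation with meshfree integration to the local limit.) Let Ω ⊂ ℝ^d be bounded, open and connected, let δ₀ > 0, M₀ > 0, M > 0, and fix ĥ ∈ (0,1]^d with maximum component 1. Let B₁ be a finite subset of the closed unit ball of ℝ^d minus the origin with −s ∈ B₁ whenever s ∈ B₁, and let ω : B₁ → [0,∞) satisfy ω(−s) = ω(s). Assume: (a) the set {s ∈ B₁ : ω(s)ρ(|s|) > 0} is not contained in any hyperplane through the origin; (b) for every ξ ∈ [−π,π]^d with ξ ≠ 0, Σ_{s∈B₁} ω(s) ρ(|s|) (1 − cos(M₀ s · (ξ ⊘ ĥ))) > 0, where (ξ ⊘ ĥ)_j = ξ_j/ĥ_j; and (c) the reproducing conditions 2 Σ_{s∈B₁} ω(s) ρ(|s|) s_i s_j = ∫_{B_1(0)} ρ(|s|) s_i s_j ds hold for all 1 ≤ i, j ≤ d. For δ > 0 define (L^ε_δ u)(x) := 2 Σ_{s∈B₁} δ^d ω(s) ρ_δ(δ|s|)(u(x + δs) − u(x)). Then there exists C > 0 depending only on Ω, δ₀, M₀, ĥ, ρ, d, B₁, ω and M such that the following holds for every δ ∈ (0, δ₀] with h :=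 (δ/M₀) ĥ: if u⁰ ∈ C⁴(ℝ^d) vanishes on ℝ^d \ Ω with sup_{|β|≤4} sup_y |D^β u⁰(y)| ≤ M, if f₀ := −Δu⁰ on Ω, if f_δ : Ω → ℝ satisfies sup_{x∈Ω} |f_δ(x) − f₀(x)| ≤ M δ², and if u^{δ,ε,h} ∈ S(□∩Ω) satisfies −L^ε_δ u^{δ,ε,h}(x_k) = f_δ(x_k) for every grid point x_k ∈ Ω, then ‖u⁰ − u^{δ,ε,h}‖_{L²(Ω)} ≤ C (h_max² + δ²), where h_max = δ/M₀. -/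

import Mathlib

open MeasureTheory Real
open scoped BigOperators

noncomputable section

/-- The cubic B-spline window function. -/
def phi (x : ℝ) : ℝ :=
  if x ≤ 1/2 then 2/3 - 4*x^2 + 4*x^3
  else if x ≤ 1 then (4/3)*(1-x)^3
  else 0

/-- Grid point `x_k = (k₁h₁, …, k_d h_d)`. -/
def gridPt (d : ℕ) (h : Fin d → ℝ) (k : Fin d → ℤ) : EuclideanSpace ℝ (Fin d) :=
  (EuclideanSpace.equiv (Fin d) ℝ).symm (fun j => (k j : ℝ) * h j)

/-- Linear RK basis function `Ψ_k`. -/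
def Psi (d : ℕ) (h : Fin d → ℝ) (k : Fin d → ℤ) (x : EuclideanSpace ℝ (Fin d)) : ℝ :=
  ∏ j, phi (|x j - (k j : ℝ) * h j| / (2 * h j))

/-- The RK function `i^h(c) = Σ_k Ψ_k c_k` with coefficient sequence `c`. -/
def RKfun (d : ℕ) (h : Fin d → ℝ) (c : (Fin d → ℤ) → ℝ) (x : EuclideanSpace ℝ (Fin d)) : ℝ :=
  ∑' k : Fin d → ℤ, Psi d h k x * c k

/-- The rescaled kernel `ρ_δ(r) = δ^{-(d+2)} ρ(r/δ)`. -/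
def rhoScaled (d : ℕ) (ρ : ℝ → ℝ) (δ : ℝ) (r : ℝ) : ℝ :=
  (δ ^ (d + 2))⁻¹ * ρ (r / δ)

/-- The quasi-discrete nonlocal diffusion operator
`L^ε_δ u(x) = 2 Σ_{s∈B₁} δ^d ω(s) ρ_δ(δ|s|)(u(x+δs) − u(x))`. -/
def quasiOp (d : ℕ) (ρ : ℝ → ℝ) (B₁ : Finset (EuclideanSpace ℝ (Fin d)))
    (ω : EuclideanSpace ℝ (Fin d) → ℝ) (δ : ℝ) (u : EuclideanSpace ℝ (Fin d) → ℝ)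
    (x : EuclideanSpace ℝ (Fin d)) : ℝ :=
  2 * ∑ s ∈ B₁, δ^d * ω s * rhoScaled d ρ δ (δ * ‖s‖) * (u (x + δ • s) - u x)

/-- First-order partial derivative in the `j`-th coordinate direction. -/
def pderiv1 (d : ℕ) (j : Fin d) (u : EuclideanSpace ℝ (Fin d) → ℝ) :
    EuclideanSpace ℝ (Fin d) → ℝ :=
  fun x => fderiv ℝ u x (EuclideanSpace.single j (1:ℝ))

/-- Multi-index partial derivative `D^α = ∂₁^{α₁} ⋯ ∂_d^{α_d}`. -/
def multiDeriv (d : ℕ) (α : Fin d → ℕ) (u : EuclideanSpace ℝ (Fin d) → ℝ) :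
    EuclideanSpace ℝ (Fin d) → ℝ :=
  (List.finRange d).foldr (fun j v => (pderiv1 d j)^[α j] v) u

/-- The Laplacian `Δu = Σ_j ∂²u/∂x_j²`. -/
def laplacian (d : ℕ) (u : EuclideanSpace ℝ (Fin d) → ℝ)
    (x : EuclideanSpace ℝ (Fin d)) : ℝ :=
  ∑ j, pderiv1 d j (pderiv1 d j u) x

def Bs (t : ℝ) : ℝ := phi (|t| / 2)

lemma Bs_neg (t : ℝ) : Bs (-t) = Bs t := by simp [Bs]

lemma Bs_zero {t : ℝ} (h : 2 ≤ |t|) : Bs t = 0 := by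
  unfold Bs phi
  rw [if_neg (by linarith)]
  split_ifs with h2
  · have : |t| = 2 := by linarith
    rw [this]; norm_num
  · rfl

lemma Bs_01 {t : ℝ} (h0 : 0 ≤ t) (h1 : t ≤ 1) : Bs t = 2/3 - t^2 + t^3/2 := by
  unfold Bs phi
  rw [abs_of_nonneg h0, if_pos (by linarith)]
  ring

lemma Bs_12 {t : ℝ} (h0 : 1 ≤ t) (h1 : t ≤ 2) : Bs t = (2-t)^3/6 := by
  rcases h0.eq_or_lt with rfl | h0
  · rw [Bs_01 (by norm_num) le_rfl]; norm_num
  unfold Bs phi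
  rw [abs_of_nonneg (by linarith), if_neg (by linarith), if_pos (by linarith)]
  ring

lemma Bs_nonneg (t : ℝ) : 0 ≤ Bs t := by
  have key : ∀ t, 0 ≤ t → 0 ≤ Bs t := by
    intro t ht
    by_cases h1 : t ≤ 1
    · rw [Bs_01 ht h1]
      have : t^2 ≤ 1 := by nlinarith
      nlinarith [mul_nonneg ht (sq_nonneg (t-1)), mul_nonneg ht (sub_nonneg.2 h1)]
    · by_cases h2 : t ≤ 2
      · rw [Bs_12 (by linarith) h2]
        have : 0 ≤ 2 - t := by linarith
        positivity
      · rw [Bs_zero (by rw [abs_of_nonneg ht]; linarith)]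
  rcases le_total 0 t with h | h
  · exact key t h
  · rw [← Bs_neg]; exact key _ (by linarith)

lemma Bs_le_one (t : ℝ) : Bs t ≤ 1 := by
  have key : ∀ t, 0 ≤ t → Bs t ≤ 1 := by
    intro t ht
    by_cases h1 : t ≤ 1
    · rw [Bs_01 ht h1]
      nlinarith [mul_nonneg (sq_nonneg t) (sub_nonneg.2 h1)]
    · by_cases h2 : t ≤ 2
      · rw [Bs_12 (by linarith) h2]
        have h3 : 0 ≤ 2 - t := by linarith
        have h4 : (2-t)^3 ≤ 1 := pow_le_one₀ h3 (by linarith)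
        linarith
      · rw [Bs_zero (by rw [abs_of_nonneg ht]; linarith)]; norm_num
  rcases le_total 0 t with h | h
  · exact key t h
  · rw [← Bs_neg]; exact key _ (by linarith)

lemma Bs_sum (t : ℝ) (S : Finset ℤ) (hS : ∀ n : ℤ, |t - n| < 2 → n ∈ S) (p : ℤ → ℝ) :
    ∑ n ∈ S, Bs (t - n) * p n =
      Bs (Int.fract t + 1) * p (⌊t⌋ - 1) + Bs (Int.fract t) * p ⌊t⌋
      + Bs (Int.fract t - 1) * p (⌊t⌋ + 1) + Bs (Int.fract t - 2) * p (⌊t⌋ + 2) := by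
  have hf0 := Int.fract_nonneg t
  have hf1 := Int.fract_lt_one t
  have hf : Int.fract t = t - ⌊t⌋ := rfl
  have h1 : ∑ n ∈ S, Bs (t - n) * p n = ∑ n ∈ ({⌊t⌋ - 1, ⌊t⌋, ⌊t⌋ + 1, ⌊t⌋ + 2} : Finset ℤ), Bs (t - n) * p n := by
    have e1 : ∑ n ∈ S, Bs (t - n) * p n = ∑ n ∈ S ∪ {⌊t⌋ - 1, ⌊t⌋, ⌊t⌋ + 1, ⌊t⌋ + 2}, Bs (t - n) * p n := by
      apply Finset.sum_subset Finset.subset_union_left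
      intro n _ hn
      rw [Bs_zero, zero_mul]
      by_contra hc
      exact hn (hS n (not_le.1 hc))
    rw [e1]
    symm
    apply Finset.sum_subset Finset.subset_union_right
    intro n _ hn
    rw [Bs_zero, zero_mul]
    simp only [Finset.mem_insert, Finset.mem_singleton, not_or] at hn
    have : n ≤ ⌊t⌋ - 2 ∨ ⌊t⌋ + 3 ≤ n := by omega
    rcases this with h | h
    · have : (n:ℝ) ≤ ⌊t⌋ - 2 := by exact_mod_cast h
      rw [le_abs]; left; linarith
    · have : (⌊t⌋:ℝ) + 3 ≤ n := by exact_mod_cast h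
      rw [le_abs]; right; linarith
  rw [h1, Finset.sum_insert (by simp; omega), Finset.sum_insert (by simp), Finset.sum_insert (by simp),
    Finset.sum_singleton, hf]
  push_cast
  rw [show t - (⌊t⌋ - 1:ℝ) = t - ⌊t⌋ + 1 by ring, show t - (⌊t⌋ + 1:ℝ) = t - ⌊t⌋ - 1 by ring,
    show t - (⌊t⌋ + 2:ℝ) = t - ⌊t⌋ - 2 by ring]
  ring

lemma Bs_vals (t : ℝ) : Bs (Int.fract t + 1) = (1 - Int.fract t)^3/6 ∧
    Bs (Int.fract t) = 2/3 - Int.fract t^2 + Int.fract t^3/2 ∧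
    Bs (Int.fract t - 1) = 2/3 - (1 - Int.fract t)^2 + (1 - Int.fract t)^3/2 ∧
    Bs (Int.fract t - 2) = Int.fract t^3/6 := by
  have hf0 := Int.fract_nonneg t
  have hf1 := Int.fract_lt_one t
  refine ⟨?_, ?_, ?_, ?_⟩
  · rw [Bs_12 (by linarith) (by linarith)]; ring
  · rw [Bs_01 hf0 hf1.le]
  · rw [← Bs_neg, Bs_01 (by linarith) (by linarith)]; ring
  · rw [← Bs_neg, Bs_12 (by linarith) (by linarith)]; ring

lemma Bs_mom0 (t : ℝ) (S : Finset ℤ) (hS : ∀ n : ℤ, |t - n| < 2 → n ∈ S) :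
    ∑ n ∈ S, Bs (t - n) = 1 := by
  have h := Bs_sum t S hS (fun _ => 1)
  simp only [mul_one] at h
  obtain ⟨a, b, c, d⟩ := Bs_vals t
  rw [h, a, b, c, d]; ring

lemma Bs_mom1 (t : ℝ) (S : Finset ℤ) (hS : ∀ n : ℤ, |t - n| < 2 → n ∈ S) :
    ∑ n ∈ S, Bs (t - n) * n = t := by
  have h := Bs_sum t S hS (fun n => n)
  obtain ⟨a, b, c, d⟩ := Bs_vals t
  have hf : (⌊t⌋:ℝ) = t - Int.fract t := by rw [← Int.self_sub_floor]; ring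
  rw [h, a, b, c, d]; push_cast; rw [hf]; ring

lemma Bs_mom2 (t : ℝ) (S : Finset ℤ) (hS : ∀ n : ℤ, |t - n| < 2 → n ∈ S) :
    ∑ n ∈ S, Bs (t - n) * n^2 = t^2 + 1/3 := by
  have h := Bs_sum t S hS (fun n => n^2)
  obtain ⟨a, b, c, d⟩ := Bs_vals t
  have hf : (⌊t⌋:ℝ) = t - Int.fract t := by rw [← Int.self_sub_floor]; ring
  rw [h, a, b, c, d]; push_cast; rw [hf]; ring

/-! d-dimensional -/
def Phi {d : ℕ} (t : Fin d → ℝ) : ℝ := ∏ j, Bs (t j)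

lemma Phi_nonneg {d : ℕ} (t : Fin d → ℝ) : 0 ≤ Phi t := Finset.prod_nonneg fun _ _ => Bs_nonneg _

lemma Phi_le_one {d : ℕ} (t : Fin d → ℝ) : Phi t ≤ 1 :=
  Finset.prod_le_one (fun _ _ => Bs_nonneg _) (fun _ _ => Bs_le_one _)

lemma Phi_zero {d : ℕ} {t : Fin d → ℝ} (j : Fin d) (h : 2 ≤ |t j|) : Phi t = 0 :=
  Finset.prod_eq_zero (Finset.mem_univ j) (Bs_zero h)

lemma Phi_neg {d : ℕ} (t : Fin d → ℝ) : Phi (-t) = Phi t := by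
  simp [Phi, Bs_neg]

lemma Phi_prod {d : ℕ} (t : Fin d → ℝ) (S : Fin d → Finset ℤ) (p : Fin d → ℤ → ℝ) :
    ∑ n ∈ Fintype.piFinset S, Phi (fun j => t j - n j) * ∏ j, p j (n j) =
      ∏ j, ∑ n ∈ S j, Bs (t j - n) * p j n := by
  rw [Finset.prod_univ_sum]
  simp [Phi, Finset.prod_mul_distrib]

lemma Phi_mom0 {d : ℕ} (t : Fin d → ℝ) (S : Fin d → Finset ℤ)
    (hS : ∀ j, ∀ n : ℤ, |t j - n| < 2 → n ∈ S j) :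
    ∑ n ∈ Fintype.piFinset S, Phi (fun j => t j - n j) = 1 := by
  have := Phi_prod t S (fun _ _ => 1)
  simp only [Finset.prod_const_one, mul_one] at this
  rw [this]
  exact Finset.prod_eq_one fun j _ => Bs_mom0 _ _ (hS j)

lemma Phi_mom1 {d : ℕ} (t : Fin d → ℝ) (S : Fin d → Finset ℤ)
    (hS : ∀ j, ∀ n : ℤ, |t j - n| < 2 → n ∈ S j) (i : Fin d) :
    ∑ n ∈ Fintype.piFinset S, Phi (fun j => t j - n j) * n i = t i := by
  have := Phi_prod t S (fun j n => if j = i then (n:ℝ) else 1)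
  simp only [Finset.prod_ite_eq', Finset.mem_univ, if_true] at this
  rw [this, Finset.prod_eq_single i]
  · simpa using Bs_mom1 (t i) (S i) (hS i)
  · intro j _ hj
    simpa [hj] using Bs_mom0 (t j) (S j) (hS j)
  · simp

lemma Phi_mom2 {d : ℕ} (t : Fin d → ℝ) (S : Fin d → Finset ℤ)
    (hS : ∀ j, ∀ n : ℤ, |t j - n| < 2 → n ∈ S j) (i k : Fin d) :
    ∑ n ∈ Fintype.piFinset S, Phi (fun j => t j - n j) * ((n i : ℝ) * n k) =
      t i * t k + if i = k then 1/3 else 0 := by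
  have := Phi_prod t S (fun j n => (if j = i then (n:ℝ) else 1) * (if j = k then (n:ℝ) else 1))
  simp only [Finset.prod_mul_distrib, Finset.prod_ite_eq', Finset.mem_univ, if_true] at this
  rw [this]
  by_cases h : i = k
  · subst h
    rw [Finset.prod_eq_single i]
    · have := Bs_mom2 (t i) (S i) (hS i)
      simp only [if_true]
      rw [← sq, ← this]
      exact Finset.sum_congr rfl fun n _ => by ring
    · intro j _ hj
      simpa [hj] using Bs_mom0 (t j) (S j) (hS j)
    · simp
  · rw [if_neg h, add_zero, ← Finset.prod_subset (Finset.subset_univ {i, k}), Finset.prod_pair h]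
    · have a := Bs_mom1 (t i) (S i) (hS i)
      have b := Bs_mom1 (t k) (S k) (hS k)
      simp only [if_true, if_neg h, if_neg (Ne.symm h), mul_one, one_mul]
      rw [a, b]
    · intro j _ hj
      simp only [Finset.mem_insert, Finset.mem_singleton, not_or] at hj
      simpa [hj.1, hj.2] using Bs_mom0 (t j) (S j) (hS j)

/-- RKfun in normalized form -/
lemma Psi_eq {d : ℕ} (h : Fin d → ℝ) (hh : ∀ j, 0 < h j) (k : Fin d → ℤ)
    (x : EuclideanSpace ℝ (Fin d)) : Psi d h k x = Phi (fun j => x j / h j - k j) := by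
  unfold Psi Phi Bs
  refine Finset.prod_congr rfl fun j _ => ?_
  congr 1
  have h1 : x j / h j - k j = (x j - k j * h j) / h j := by
    have := (hh j).ne'
    field_simp
  show _ = |x j / h j - k j| / 2
  rw [h1, abs_div, abs_of_pos (hh j)]
  have := (hh j).ne'
  field_simp

lemma RK_eq_S {d : ℕ} (h : Fin d → ℝ) (hh : ∀ j, 0 < h j) (c : (Fin d → ℤ) → ℝ)
    (S : Finset (Fin d → ℤ)) (hc : ∀ k, k ∉ S → c k = 0)
    (x : EuclideanSpace ℝ (Fin d)) :
    RKfun d h c x = ∑ k ∈ S, Phi (fun j => x j / h j - k j) * c k := by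
  unfold RKfun
  rw [tsum_eq_sum (s := S)]
  · exact Finset.sum_congr rfl fun k _ => by rw [Psi_eq h hh]
  · intro k hk; rw [hc k hk, mul_zero]

lemma RK_eq_box {d : ℕ} (h : Fin d → ℝ) (hh : ∀ j, 0 < h j) (c : (Fin d → ℤ) → ℝ)
    (x : EuclideanSpace ℝ (Fin d)) (S : Fin d → Finset ℤ)
    (hS : ∀ j, ∀ n : ℤ, |x j / h j - n| < 2 → n ∈ S j) :
    RKfun d h c x = ∑ k ∈ Fintype.piFinset S, Phi (fun j => x j / h j - k j) * c k := by
  unfold RKfun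
  rw [tsum_eq_sum (s := Fintype.piFinset S)]
  · exact Finset.sum_congr rfl fun k _ => by rw [Psi_eq h hh]
  · intro k hk
    simp only [Fintype.mem_piFinset, not_forall] at hk
    obtain ⟨j, hj⟩ := hk
    rw [Psi_eq h hh, Phi_zero j, zero_mul]
    by_contra hc
    exact hj (hS j _ (not_le.1 hc))

def hat (z : ℝ) : ℝ := max 0 (1 - |z|)
def gdual (z : ℝ) : ℝ := Set.indicator (Set.Ioc 0 1) (fun z => 4 - 6 * z) z

lemma hat_pos {z : ℝ} (h0 : 0 ≤ z) (h1 : z ≤ 1) : hat z = 1 - z := by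
  unfold hat; rw [abs_of_nonneg h0, max_eq_right (by linarith)]
lemma hat_npos {z : ℝ} (h0 : z ≤ 0) (h1 : -1 ≤ z) : hat z = 1 + z := by
  unfold hat; rw [abs_of_nonpos h0, max_eq_right (by linarith)]; ring
lemma hat_zero {z : ℝ} (h0 : 1 ≤ |z|) : hat z = 0 := by
  unfold hat; rw [max_eq_left (by linarith)]
lemma hat_neg (z : ℝ) : hat (-z) = hat z := by simp [hat]
lemma hat_cont : Continuous hat := by unfold hat; fun_prop

lemma int_supp (f : ℝ → ℝ) (a b : ℝ) (hab : a ≤ b) (h : ∀ z, z ∉ Set.Ioc a b → f z = 0) :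
    ∫ z, f z = ∫ z in a..b, f z := by
  rw [intervalIntegral.integral_of_le hab, setIntegral_eq_integral_of_forall_compl_eq_zero h]

lemma int_poly (f p P : ℝ → ℝ) (a b : ℝ) (hab : a ≤ b) (h : ∀ z, a ≤ z → z ≤ b → f z = p z)
    (hp : Continuous p) (hP : ∀ z, HasDerivAt P (p z) z) : ∫ z in a..b, f z = P b - P a := by
  rw [intervalIntegral.integral_congr (g := p)]
  · exact intervalIntegral.integral_eq_sub_of_hasDerivAt (fun z _ => hP z) (hp.intervalIntegrable _ _)
  · intro z hz
    rw [Set.uIcc_of_le hab] at hz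
    exact h z hz.1 hz.2

lemma hasDeriv_quad (A B C z : ℝ) :
    HasDerivAt (fun z : ℝ => A * z + B * z^2/2 + C * z^3/3) (A + B * z + C * z^2) z := by
  have h1 := (hasDerivAt_id z).const_mul A
  have h2 := ((hasDerivAt_pow 2 z).const_mul B).div_const 2
  have h3 := ((hasDerivAt_pow 3 z).const_mul C).div_const 3
  have := (h1.add h2).add h3
  refine this.congr_deriv ?_
  norm_num
  ring

lemma int_quad (f : ℝ → ℝ) (A B C : ℝ) (a b : ℝ) (hab : a ≤ b)
    (h : ∀ z, a ≤ z → z ≤ b → f z = A + B * z + C * z^2) :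
    ∫ z in a..b, f z = (A * b + B * b^2/2 + C * b^3/3) - (A * a + B * a^2/2 + C * a^3/3) :=
  int_poly f (fun z => A + B * z + C * z^2) (fun z : ℝ => A * z + B * z^2/2 + C * z^3/3) a b hab h
    (by fun_prop) (fun z => hasDeriv_quad A B C z)

lemma hat_auto (x : ℝ) (hx : 0 ≤ x) : ∫ z, hat z * hat (z - x) = Bs x := by
  have hc : Continuous fun z => hat z * hat (z - x) := by
    have := hat_cont
    fun_prop
  by_cases h2 : 2 ≤ x
  · rw [Bs_zero (by rwa [abs_of_nonneg hx])]
    rw [show (fun z => hat z * hat (z - x)) = fun _ => 0 from ?_]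
    · simp
    · funext z
      by_cases hz : 1 ≤ z
      · rw [hat_zero (by rw [le_abs]; left; exact hz), zero_mul]
      · rw [hat_zero (z := z - x) (by rw [le_abs]; right; linarith), mul_zero]
  push Not at h2
  rw [int_supp _ (x - 1) 1 (by linarith)]
  · by_cases h1 : x ≤ 1
    · rw [Bs_01 hx h1]
      rw [← intervalIntegral.integral_add_adjacent_intervals (b := 0) (hc.intervalIntegrable _ _) (hc.intervalIntegrable _ _),
        ← intervalIntegral.integral_add_adjacent_intervals (a := 0) (b := x) (hc.intervalIntegrable _ _) (hc.intervalIntegrable _ _)]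
      rw [int_quad _ (1-x) (2-x) 1 (x-1) 0 (by linarith), int_quad _ (1-x) x (-1) 0 x hx,
        int_quad _ (1+x) (-2-x) 1 x 1 h1]
      · ring
      · intro z h3 h4
        rw [hat_pos (by linarith) (by linarith), hat_pos (by linarith) (by linarith)]; ring
      · intro z h3 h4
        rw [hat_pos (by linarith) (by linarith), hat_npos (by linarith) (by linarith)]; ring
      · intro z h3 h4
        rw [hat_npos (by linarith) (by linarith), hat_npos (by linarith) (by linarith)]; ring
    · push Not at h1
      rw [Bs_12 h1.le h2.le]
      rw [int_quad _ (1-x) x (-1) (x-1) 1 (by linarith)]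
      · ring
      · intro z h3 h4
        rw [hat_pos (by linarith) (by linarith), hat_npos (by linarith) (by linarith)]; ring
  · intro z hz
    rw [Set.mem_Ioc, not_and_or] at hz
    rcases hz with hz | hz
    · rw [hat_zero (z := z - x) (by rw [le_abs]; right; linarith), mul_zero]
    · rw [hat_zero (by rw [le_abs]; left; linarith), zero_mul]

lemma hat_corr (x y : ℝ) : ∫ z, hat (z - x) * hat (z - y) = Bs (x - y) := by
  have key : ∀ x y : ℝ, x ≤ y → ∫ z, hat (z - x) * hat (z - y) = Bs (x - y) := by
    intro x y h
    have := integral_sub_right_eq_self (μ := volume) (fun z => hat z * hat (z - (y - x))) x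
    simp only [sub_sub_sub_cancel_right, sub_sub, add_sub_cancel] at this
    rw [this, hat_auto _ (by linarith), ← Bs_neg]; congr 1; ring
  rcases le_total x y with h | h
  · exact key x y h
  · rw [← Bs_neg, show -(x-y) = y - x by ring, ← key y x h]
    congr 1; funext z; ring

lemma gdual_int (f : ℝ → ℝ) : ∫ z, f z * gdual z = ∫ z in (0:ℝ)..1, f z * (4 - 6 * z) := by
  rw [int_supp _ 0 1 zero_le_one, intervalIntegral.integral_of_le zero_le_one, intervalIntegral.integral_of_le zero_le_one]
  · apply setIntegral_congr_fun measurableSet_Ioc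
    intro z hz
    simp only [gdual, Set.indicator_of_mem hz]
  · intro z hz
    simp only [gdual, Set.indicator_of_notMem hz, mul_zero]

lemma hat_gdual (m k : ℤ) : ∫ z, hat (z - m) * gdual (z - k) = if m = k then 1 else 0 := by
  have := integral_sub_right_eq_self (μ := volume) (fun z => hat (z + (k - m)) * gdual z) (k:ℝ)
  simp only [sub_add_sub_cancel] at this
  rw [this, gdual_int]
  split_ifs with h
  · subst h
    rw [int_quad _ 4 (-10) 6 0 1 zero_le_one]
    · norm_num
    · intro z h0 h1
      rw [sub_self, add_zero, hat_pos h0 h1]; ring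
  · by_cases h' : m = k + 1
    · subst h'
      rw [int_quad _ 0 4 (-6) 0 1 zero_le_one]
      · norm_num
      · intro z h0 h1
        push_cast
        rw [hat_npos (by linarith) (by linarith)]; ring
    · rw [int_quad _ 0 0 0 0 1 zero_le_one]
      · norm_num
      · intro z h0 h1
        rw [hat_zero]
        · ring
        · have : m ≤ k - 1 ∨ k + 2 ≤ m := by omega
          rcases this with h | h
          · have : (m:ℝ) ≤ k - 1 := by exact_mod_cast h
            rw [le_abs]; left; linarith
          · have : (k:ℝ) + 2 ≤ m := by exact_mod_cast h
            rw [le_abs]; right; linarith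

lemma gdual_gdual (m k : ℤ) : ∫ z, gdual (z - m) * gdual (z - k) = if m = k then 4 else 0 := by
  split_ifs with h
  · subst h
    have := integral_sub_right_eq_self (μ := volume) (fun z => gdual z * gdual z) (m:ℝ)
    rw [this, gdual_int]
    have e : ∫ z in (0:ℝ)..1, gdual z * (4 - 6 * z) = ∫ z in (0:ℝ)..1, (4 - 6 * z) * (4 - 6 * z) := by
      rw [intervalIntegral.integral_of_le zero_le_one, intervalIntegral.integral_of_le zero_le_one]
      apply setIntegral_congr_fun measurableSet_Ioc
      intro z hz
      simp only [gdual, Set.indicator_of_mem hz]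
    rw [e, int_quad _ 16 (-48) 36 0 1 zero_le_one]
    · norm_num
    · intro z h0 h1
      ring
  · rw [show (fun z => gdual (z - m) * gdual (z - k)) = fun _ => (0:ℝ) from ?_]
    · simp
    · funext z
      by_cases h1 : z - m ∈ Set.Ioc (0:ℝ) 1
      · by_cases h2 : z - k ∈ Set.Ioc (0:ℝ) 1
        · exfalso
          have : m < k + 1 := by have := h1.1; have := h2.2; exact_mod_cast (by linarith : (m:ℝ) < k + 1)
          have : k < m + 1 := by have := h2.1; have := h1.2; exact_mod_cast (by linarith : (k:ℝ) < m + 1)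
          omega
        · simp only [gdual, Set.indicator_of_notMem h2, mul_zero]
      · simp only [gdual, Set.indicator_of_notMem h1, zero_mul]

lemma hat_memLp (x : ℝ) : MemLp (fun z => hat (z - x)) 2 (volume : Measure ℝ) := by
  apply Continuous.memLp_of_hasCompactSupport
  · have := hat_cont; fun_prop
  · apply HasCompactSupport.of_support_subset_isCompact (isCompact_Icc (a := x - 1) (b := x + 1))
    intro z hz
    by_contra hc
    apply hz
    apply hat_zero
    rw [Set.mem_Icc, not_and_or] at hc
    rw [le_abs]
    rcases hc with h | h
    · right; linarith
    · left; linarith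

lemma gdual_memLp (x : ℝ) : MemLp (fun z => gdual (z - x)) 2 (volume : Measure ℝ) := by
  have e : (fun z => gdual (z - x)) = Set.indicator (Set.Ioc x (x+1)) (fun z => 4 - 6 * (z - x)) := by
    funext z
    unfold gdual
    by_cases h : z ∈ Set.Ioc x (x+1)
    · rw [Set.indicator_of_mem h, Set.indicator_of_mem]
      exact ⟨by linarith [h.1], by linarith [h.2]⟩
    · rw [Set.indicator_of_notMem h, Set.indicator_of_notMem]
      intro h'
      exact h ⟨by linarith [h'.1], by linarith [h'.2]⟩
  rw [e, memLp_indicator_iff_restrict measurableSet_Ioc]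
  apply MemLp.of_bound (C := 10)
  · apply Continuous.aestronglyMeasurable; fun_prop
  · rw [ae_restrict_iff' measurableSet_Ioc]
    filter_upwards with z hz
    rw [Real.norm_eq_abs, abs_le]
    constructor <;> linarith [hz.1, hz.2]

abbrev HS (d : ℕ) := Lp ℝ 2 (volume : Measure (Fin d → ℝ))

lemma prod_memLp {d : ℕ} (f : Fin d → ℝ → ℝ) (hf : ∀ j, MemLp (f j) 2 (volume : Measure ℝ)) :
    MemLp (fun z : Fin d → ℝ => ∏ j, f j (z j)) 2 volume := by
  rw [memLp_two_iff_integrable_sq]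
  · simp_rw [← Finset.prod_pow]
    exact Integrable.fintype_prod (f := fun j z => f j z ^ 2) (fun j => (hf j).integrable_sq)
  · apply Finset.aestronglyMeasurable_fun_prod
    intro j _
    exact (hf j).1.comp_quasiMeasurePreserving (Measure.quasiMeasurePreserving_eval _ j)

def Tn {d : ℕ} (f : Fin d → ℝ → ℝ) (hf : ∀ j, MemLp (f j) 2 (volume : Measure ℝ)) : HS d :=
  (prod_memLp f hf).toLp

lemma Tn_inner {d : ℕ} (f g : Fin d → ℝ → ℝ) (hf : ∀ j, MemLp (f j) 2 (volume : Measure ℝ))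
    (hg : ∀ j, MemLp (g j) 2 (volume : Measure ℝ)) :
    inner ℝ (Tn f hf) (Tn g hg) = ∏ j, ∫ z, f j z * g j z := by
  rw [L2.inner_def]
  have h1 := (prod_memLp f hf).coeFn_toLp
  have h2 := (prod_memLp g hg).coeFn_toLp
  rw [← integral_fintype_prod_volume_eq_prod (fun j z => f j z * g j z)]
  apply integral_congr_ae
  filter_upwards [h1, h2] with z hz1 hz2
  unfold Tn
  rw [hz1, hz2]
  simp [Finset.prod_mul_distrib, mul_comm]

def FF {d : ℕ} (x : Fin d → ℝ) : HS d := Tn (fun j z => hat (z - x j)) (fun j => hat_memLp _)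
def GG {d : ℕ} (k : Fin d → ℤ) : HS d := Tn (fun j z => gdual (z - k j)) (fun j => gdual_memLp _)

lemma FF_FF {d : ℕ} (x y : Fin d → ℝ) : inner ℝ (FF x) (FF y) = Phi (fun j => x j - y j) := by
  unfold FF Phi
  rw [Tn_inner]
  exact Finset.prod_congr rfl fun j _ => hat_corr _ _

lemma prod_ite_eq_fun {d : ℕ} (m k : Fin d → ℤ) (a : ℝ) :
    ∏ j, (if m j = k j then a else 0) = if m = k then a^d else 0 := by
  split_ifs with h
  · subst h; simp
  · obtain ⟨j, hj⟩ := Function.ne_iff.1 h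
    exact Finset.prod_eq_zero (Finset.mem_univ j) (by simp [hj])

lemma FF_GG {d : ℕ} (m k : Fin d → ℤ) :
    inner ℝ (FF (fun j => (m j : ℝ))) (GG k) = if m = k then 1 else 0 := by
  unfold FF GG
  rw [Tn_inner]
  simp_rw [hat_gdual]
  rw [prod_ite_eq_fun]; simp

lemma GG_GG {d : ℕ} (m k : Fin d → ℤ) :
    inner ℝ (GG m) (GG k) = if m = k then (4:ℝ)^d else 0 := by
  unfold GG
  rw [Tn_inner]
  simp_rw [gdual_gdual]
  rw [prod_ite_eq_fun]

/-! energy -/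
def EE {d : ℕ} (S : Finset (Fin d → ℤ)) (e : (Fin d → ℤ) → ℝ) (y : Fin d → ℝ) : HS d :=
  ∑ k ∈ S, e k • FF (fun j => k j + y j)

def KK {d : ℕ} (S : Finset (Fin d → ℤ)) (e : (Fin d → ℤ) → ℝ) (y : Fin d → ℝ) : ℝ :=
  ∑ k ∈ S, ∑ m ∈ S, e k * e m * Phi (fun j => k j + y j - m j)

lemma EE_inner {d : ℕ} (S : Finset (Fin d → ℤ)) (e : (Fin d → ℤ) → ℝ) (y z : Fin d → ℝ) :
    inner ℝ (EE S e y) (EE S e z) = KK S e (fun j => y j - z j) := by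
  unfold EE KK
  simp_rw [sum_inner, inner_sum, inner_smul_left, inner_smul_right, FF_FF]
  refine Finset.sum_congr rfl fun k _ => Finset.sum_congr rfl fun m _ => ?_
  simp only [conj_trivial]
  rw [← mul_assoc]
  congr 2
  funext j; ring

lemma KK_lower {d : ℕ} (S : Finset (Fin d → ℤ)) (e : (Fin d → ℤ) → ℝ) :
    ∑ k ∈ S, e k ^ 2 ≤ 4^d * KK S e 0 := by
  set P : HS d := ∑ k ∈ S, e k • GG k with hP
  set A := ∑ k ∈ S, e k ^ 2 with hA
  have h1 : inner ℝ (EE S e 0) P = A := by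
    have e0 : EE S e 0 = ∑ k ∈ S, e k • FF (fun j => (k j:ℝ)) := by simp [EE]
    rw [e0, hP]
    simp_rw [sum_inner, inner_sum, inner_smul_left, inner_smul_right, FF_GG]
    rw [hA]
    refine Finset.sum_congr rfl fun k hk => ?_
    simp [hk, sq]
  have h2 : inner ℝ P P = 4^d * A := by
    rw [hP]
    simp_rw [sum_inner, inner_sum, inner_smul_left, inner_smul_right, GG_GG]
    rw [hA, Finset.mul_sum]
    refine Finset.sum_congr rfl fun k hk => ?_
    simp [hk]; ring
  have h3 := real_inner_mul_inner_self_le (EE S e 0) P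
  rw [h1, h2, EE_inner] at h3
  have h0 : (fun j => (0 : Fin d → ℝ) j - (0 : Fin d → ℝ) j) = 0 := by funext j; simp
  rw [h0] at h3
  have hA0 : 0 ≤ A := Finset.sum_nonneg fun k _ => sq_nonneg _
  rcases hA0.eq_or_lt with h | h
  · rw [← h]
    have := real_inner_self_nonneg (x := EE S e 0)
    rw [EE_inner, h0] at this
    positivity
  · nlinarith

lemma EE_norm {d : ℕ} (S : Finset (Fin d → ℤ)) (e : (Fin d → ℤ) → ℝ) (y z : Fin d → ℝ) :
    ‖EE S e y - EE S e z‖^2 = 2 * (KK S e 0 - KK S e (fun j => y j - z j)) := by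
  rw [norm_sub_sq_real, ← real_inner_self_eq_norm_sq, ← real_inner_self_eq_norm_sq, EE_inner,
    EE_inner, EE_inner]
  have h0 : ∀ y : Fin d → ℝ, (fun j => y j - y j) = 0 := by intro y; funext j; simp
  rw [h0, h0]; ring

lemma KK_diff_nonneg {d : ℕ} (S : Finset (Fin d → ℤ)) (e : (Fin d → ℤ) → ℝ) (y : Fin d → ℝ) :
    0 ≤ KK S e 0 - KK S e y := by
  have := EE_norm S e y 0
  simp only [Pi.zero_apply, sub_zero] at this
  have h2 := sq_nonneg ‖EE S e y - EE S e 0‖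
  change _ = 2 * (KK S e 0 - KK S e y) at this
  linarith

lemma KK_diff {d : ℕ} (S : Finset (Fin d → ℤ)) (e : (Fin d → ℤ) → ℝ) (y : Fin d → ℝ) (n : ℕ) :
    KK S e 0 - KK S e (fun j => n * y j) ≤ n^2 * (KK S e 0 - KK S e y) := by
  have h1 : ∀ n : ℕ, ‖EE S e (fun j => n * y j) - EE S e 0‖ ≤ n * ‖EE S e y - EE S e 0‖ := by
    intro n
    induction n with
    | zero =>
      have : (fun j => ((0:ℕ):ℝ) * y j) = 0 := by funext j; simp
      rw [this]; simp
    | succ n ih =>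
      have h2 : ‖EE S e (fun j => (n+1:ℕ) * y j) - EE S e (fun j => n * y j)‖ = ‖EE S e y - EE S e 0‖ := by
        rw [← sq_eq_sq₀ (norm_nonneg _) (norm_nonneg _), EE_norm, EE_norm]
        congr 3
        funext j; push_cast; simp; ring
      have h3 := norm_sub_le_norm_sub_add_norm_sub (EE S e (fun j => (n+1:ℕ) * y j)) (EE S e (fun j => n * y j)) (EE S e 0)
      rw [h2] at h3
      push_cast at h3 ⊢
      linarith
  have h2 := pow_le_pow_left₀ (norm_nonneg _) (h1 n) 2
  rw [mul_pow, EE_norm, EE_norm] at h2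
  simp only [Pi.zero_apply, sub_zero] at h2
  change 2 * (KK S e 0 - KK S e fun j => n * y j) ≤ n^2 * (2 * (KK S e 0 - KK S e y)) at h2
  linarith

def DL {d : ℕ} (l : List (Fin d)) (u : EuclideanSpace ℝ (Fin d) → ℝ) : EuclideanSpace ℝ (Fin d) → ℝ :=
  l.foldr (pderiv1 d) u

lemma pderiv1_contDiff {d : ℕ} (j : Fin d) {u : EuclideanSpace ℝ (Fin d) → ℝ} {m n : ℕ}
    (hmn : m + 1 ≤ n) (hu : ContDiff ℝ n u) : ContDiff ℝ m (pderiv1 d j u) := by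
  unfold pderiv1
  exact (hu.fderiv_right (m := m) (by exact_mod_cast hmn)).clm_apply contDiff_const

lemma DL_contDiff {d : ℕ} (l : List (Fin d)) {u : EuclideanSpace ℝ (Fin d) → ℝ} {n : ℕ}
    (hu : ContDiff ℝ n u) (m : ℕ) (hm : m + l.length ≤ n) : ContDiff ℝ m (DL l u) := by
  induction l generalizing m with
  | nil => exact hu.of_le (by exact_mod_cast hm)
  | cons a l ih =>
    exact pderiv1_contDiff a (le_refl (m+1)) (ih (m+1) (by simp at hm; omega))

lemma pderiv1_comm {d : ℕ} (i j : Fin d) {u : EuclideanSpace ℝ (Fin d) → ℝ} (hu : ContDiff ℝ 2 u) :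
    pderiv1 d i (pderiv1 d j u) = pderiv1 d j (pderiv1 d i u) := by
  funext x
  have hd : DifferentiableAt ℝ (fderiv ℝ u) x :=
    ((hu.fderiv_right (m := 1) (by norm_num)).differentiable (by norm_num)) x
  have key : ∀ a b : Fin d, pderiv1 d a (pderiv1 d b u) x =
      fderiv ℝ (fderiv ℝ u) x (EuclideanSpace.single a 1) (EuclideanSpace.single b 1) := by
    intro a b
    unfold pderiv1
    rw [fderiv_clm_apply hd (differentiableAt_const _)]
    simp
  rw [key, key]
  have hs : IsSymmSndFDerivAt ℝ u x := hu.contDiffAt.isSymmSndFDerivAt (by simp)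
  exact hs _ _

lemma DL_perm {d : ℕ} {l₁ l₂ : List (Fin d)} (h : l₁.Perm l₂) {u : EuclideanSpace ℝ (Fin d) → ℝ} {n : ℕ}
    (hu : ContDiff ℝ n u) (hn : l₁.length ≤ n) : DL l₁ u = DL l₂ u := by
  induction h with
  | nil => rfl
  | cons a _ ih =>
    show pderiv1 d a _ = pderiv1 d a _
    have := ih (by simp at hn; omega)
    unfold DL at this
    rw [this]
  | swap a b l =>
    exact pderiv1_comm _ _ (DL_contDiff l hu 2 (by simp at hn; omega))
  | trans h1 _ ih1 ih2 =>
    rw [ih1 hn, ih2 (by rw [← h1.length_eq]; exact hn)]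

lemma foldr_replicate_it {d : ℕ} (j : Fin d) (n : ℕ) (u : EuclideanSpace ℝ (Fin d) → ℝ) :
    (List.replicate n j).foldr (pderiv1 d) u = (pderiv1 d j)^[n] u := by
  induction n with
  | zero => rfl
  | succ n ih => rw [List.replicate_succ, List.foldr_cons, ih, Function.iterate_succ_apply']

lemma multiDeriv_eq {d : ℕ} (α : Fin d → ℕ) (u : EuclideanSpace ℝ (Fin d) → ℝ) :
    multiDeriv d α u = DL ((List.finRange d).flatMap (fun j => List.replicate (α j) j)) u := by
  unfold multiDeriv
  generalize List.finRange d = L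
  induction L with
  | nil => rfl
  | cons a L ih =>
    rw [List.foldr_cons, ih, List.flatMap_cons]
    unfold DL
    rw [List.foldr_append, foldr_replicate_it]

lemma DL_bound {d : ℕ} {u : EuclideanSpace ℝ (Fin d) → ℝ} (hu : ContDiff ℝ 4 u) {M : ℝ}
    (hM : ∀ β : Fin d → ℕ, (∑ j, β j) ≤ 4 → ∀ y, |multiDeriv d β u y| ≤ M)
    (l : List (Fin d)) (hl : l.length ≤ 4) (y : EuclideanSpace ℝ (Fin d)) : |DL l u y| ≤ M := by
  have hp : l.Perm ((List.finRange d).flatMap (fun j => List.replicate (l.count j) j)) := by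
    rw [List.perm_iff_count]
    intro i
    rw [List.count_flatMap, ← Fin.sum_univ_def]
    simp [List.count_replicate]
  rw [DL_perm hp (n := 4) hu hl, ← multiDeriv_eq]
  apply hM
  have := Multiset.sum_count_eq_card (s := Finset.univ) (m := (l : Multiset (Fin d))) (by simp)
  simp at this
  rw [this]; exact hl

lemma clm_coord_sum {d : ℕ} (L : EuclideanSpace ℝ (Fin d) →L[ℝ] ℝ) (v : EuclideanSpace ℝ (Fin d)) :
    L v = ∑ j, v j * L (EuclideanSpace.single j 1) := by
  conv_lhs => rw [← (EuclideanSpace.basisFun (Fin d) ℝ).sum_repr v]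
  simp [map_sum]

def TF {d : ℕ} (u : EuclideanSpace ℝ (Fin d) → ℝ) (x v : EuclideanSpace ℝ (Fin d)) :
    ℕ → List (Fin d) → ℝ → ℝ
  | 0, l, t => DL l u (x + t • v)
  | m+1, l, t => ∑ j, v j * TF u x v m (j :: l) t

lemma TF_deriv {d : ℕ} {u : EuclideanSpace ℝ (Fin d) → ℝ} (hu : ContDiff ℝ 4 u)
    (x v : EuclideanSpace ℝ (Fin d)) (m : ℕ) (l : List (Fin d)) (hl : l.length + m + 1 ≤ 4) (t : ℝ) :
    HasDerivAt (TF u x v m l) (TF u x v (m+1) l t) t := by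
  induction m generalizing l with
  | zero =>
    have h1 : ContDiff ℝ 1 (DL l u) := DL_contDiff l (n := 4) hu 1 (by omega)
    have h2 : HasFDerivAt (DL l u) (fderiv ℝ (DL l u) (x + t • v)) (x + t • v) :=
      (h1.differentiable (by norm_num) _).hasFDerivAt
    have h3 : HasDerivAt (fun t : ℝ => x + t • v) v t := by
      simpa using ((hasDerivAt_id t).smul_const v).const_add x
    have h4 := h2.comp_hasDerivAt t h3
    rw [clm_coord_sum] at h4
    exact h4
  | succ m ih =>
    have : HasDerivAt (fun t => ∑ j, v j * TF u x v m (j :: l) t)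
        (∑ j, v j * TF u x v (m+1) (j :: l) t) t := by
      apply HasDerivAt.fun_sum
      intro j _
      exact (ih (j :: l) (by simp; omega)).const_mul _
    exact this

lemma TF_bound {d : ℕ} {u : EuclideanSpace ℝ (Fin d) → ℝ} (hu : ContDiff ℝ 4 u) {M : ℝ}
    (hM : ∀ β : Fin d → ℕ, (∑ j, β j) ≤ 4 → ∀ y, |multiDeriv d β u y| ≤ M)
    (x v : EuclideanSpace ℝ (Fin d)) (m : ℕ) (l : List (Fin d)) (hl : l.length + m ≤ 4) (t : ℝ) :
    |TF u x v m l t| ≤ (∑ j, |v j|)^m * M := by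
  induction m generalizing l with
  | zero => simpa [TF] using DL_bound hu hM l (by omega) _
  | succ m ih =>
    calc |TF u x v (m+1) l t| ≤ ∑ j, |v j * TF u x v m (j :: l) t| := Finset.abs_sum_le_sum_abs _ _
      _ ≤ ∑ j, |v j| * ((∑ j, |v j|)^m * M) := by
        apply Finset.sum_le_sum
        intro j _
        rw [abs_mul]
        exact mul_le_mul_of_nonneg_left (ih _ (by simp; omega)) (abs_nonneg _)
      _ = _ := by rw [← Finset.sum_mul]; ring

lemma mv_bound (F F' : ℝ → ℝ) (h : ∀ t, HasDerivAt F (F' t) t) (h0 : F 0 = 0) (K : ℝ)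
    (hb : ∀ t, 0 ≤ t → t ≤ 1 → |F' t| ≤ K) : ∀ t, 0 ≤ t → t ≤ 1 → |F t| ≤ K := by
  intro t ht0 ht1
  have hK : 0 ≤ K := (abs_nonneg _).trans (hb 0 le_rfl zero_le_one)
  have := Convex.norm_image_sub_le_of_norm_hasDerivWithin_le (s := Set.Icc (0:ℝ) 1) (f := F) (f' := F')
    (C := K) (x := 0) (y := t) (fun z _ => (h z).hasDerivWithinAt) (fun z hz => hb z hz.1 hz.2)
    (convex_Icc 0 1) ⟨le_rfl, zero_le_one⟩ ⟨ht0, ht1⟩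
  rw [h0] at this
  simp only [sub_zero, Real.norm_eq_abs, abs_of_nonneg ht0] at this
  nlinarith

lemma taylor2 {d : ℕ} {u : EuclideanSpace ℝ (Fin d) → ℝ} (hu : ContDiff ℝ 4 u) {M : ℝ}
    (hM : ∀ β : Fin d → ℕ, (∑ j, β j) ≤ 4 → ∀ y, |multiDeriv d β u y| ≤ M)
    (x v : EuclideanSpace ℝ (Fin d)) :
    |u (x + v) - u x - ∑ j, v j * pderiv1 d j u x| ≤ (∑ j, |v j|)^2 * M := by
  set g := TF u x v with hg
  have d0 := TF_deriv hu x v 0 [] (by simp)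
  have d1 := TF_deriv hu x v 1 [] (by simp)
  have b2 := TF_bound hu hM x v 2 [] (by simp)
  have s1 := mv_bound (fun t => g 1 [] t - g 1 [] 0) (g 2 []) (fun t => (d1 t).sub_const _) (by simp)
    _ (fun t _ _ => b2 t)
  have s0 := mv_bound (fun t => g 0 [] t - g 0 [] 0 - t * g 1 [] 0) (fun t => g 1 [] t - g 1 [] 0)
    (fun t => (((d0 t).sub_const (g 0 [] 0)).sub ((hasDerivAt_id t).mul_const (g 1 [] 0))).congr_deriv
      (by rw [one_mul])) (by simp) _ s1
  have := s0 1 zero_le_one le_rfl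
  simpa [hg, TF, DL] using this

lemma taylor4 {d : ℕ} {u : EuclideanSpace ℝ (Fin d) → ℝ} (hu : ContDiff ℝ 4 u) {M : ℝ}
    (hM : ∀ β : Fin d → ℕ, (∑ j, β j) ≤ 4 → ∀ y, |multiDeriv d β u y| ≤ M)
    (x v : EuclideanSpace ℝ (Fin d)) :
    |u (x + v) + u (x - v) - 2 * u x - ∑ i, ∑ j, v i * v j * pderiv1 d j (pderiv1 d i u) x| ≤
      2 * ((∑ j, |v j|)^4 * M) := by
  set g := TF u x v with hg
  have dd : ∀ m, m + 1 ≤ 4 → ∀ t, HasDerivAt (g m []) (g (m+1) [] t) t :=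
    fun m hm t => TF_deriv hu x v m [] (by simpa using hm) t
  have dn : ∀ m, m + 1 ≤ 4 → ∀ t, HasDerivAt (fun t => g m [] (-t)) (-g (m+1) [] (-t)) t := by
    intro m hm t
    exact ((dd m hm (-t)).comp t (hasDerivAt_neg t)).congr_deriv (by ring)
  have b4 := TF_bound hu hM x v 4 [] (by simp)
  have s3 := mv_bound (fun t => g 3 [] t - g 3 [] (-t)) (fun t => g 4 [] t - -g 4 [] (-t))
    (fun t => (dd 3 (by norm_num) t).sub (dn 3 (by norm_num) t)) (by simp)
    (2 * ((∑ j, |v j|)^4 * M)) (fun t _ _ => by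
      have h1 := b4 t
      have h2 := b4 (-t)
      rw [abs_le] at *
      constructor <;> linarith [h1.1, h1.2, h2.1, h2.2])
  have s2 := mv_bound (fun t => g 2 [] t + g 2 [] (-t) - 2 * g 2 [] 0) (fun t => g 3 [] t - g 3 [] (-t))
    (fun t => (((dd 2 (by norm_num) t).add (dn 2 (by norm_num) t)).sub_const _).congr_deriv (by ring))
    (by simp; ring) _ s3
  have s1 := mv_bound (fun t => g 1 [] t - g 1 [] (-t) - 2 * t * g 2 [] 0)
    (fun t => g 2 [] t + g 2 [] (-t) - 2 * g 2 [] 0)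
    (fun t => (((dd 1 (by norm_num) t).sub (dn 1 (by norm_num) t)).sub
      (((hasDerivAt_id t).const_mul 2).mul_const _)).congr_deriv (by ring))
    (by simp) _ s2
  have s0 := mv_bound (fun t => g 0 [] t + g 0 [] (-t) - 2 * g 0 [] 0 - t^2 * g 2 [] 0)
    (fun t => g 1 [] t - g 1 [] (-t) - 2 * t * g 2 [] 0)
    (fun t => ((((dd 0 (by norm_num) t).add (dn 0 (by norm_num) t)).sub_const _).sub
      ((hasDerivAt_pow 2 t).mul_const _)).congr_deriv (by norm_num; ring))
    (by simp; ring) _ s1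
  have := s0 1 zero_le_one le_rfl
  simpa [hg, TF, DL, Finset.mul_sum, ← mul_assoc, ← sub_eq_add_neg] using this

/-! isotropy -/
lemma isotropy (d : ℕ) (hd : 1 ≤ d) (ρ : ℝ → ℝ)
    (hρ_mom2 : ∫ s in Metric.ball (0 : EuclideanSpace ℝ (Fin d)) 1,
        ρ ‖s‖ * ‖s‖^2 = 2 * d) (i j : Fin d) :
    ∫ s in Metric.ball (0 : EuclideanSpace ℝ (Fin d)) 1, ρ ‖s‖ * (s i * s j) = if i = j then 2 else 0 := by
  have inv : ∀ (T : EuclideanSpace ℝ (Fin d) ≃ₗᵢ[ℝ] EuclideanSpace ℝ (Fin d))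
      (f : EuclideanSpace ℝ (Fin d) → ℝ),
      ∫ s in Metric.ball (0 : EuclideanSpace ℝ (Fin d)) 1, f (T s) =
      ∫ s in Metric.ball (0 : EuclideanSpace ℝ (Fin d)) 1, f s := by
    intro T f
    have h1 := T.measurePreserving.setIntegral_preimage_emb T.toMeasurableEquiv.measurableEmbedding f
      (Metric.ball 0 1)
    rw [← h1]
    congr 2
    ext s; simp
  have hint : IntegrableOn (fun s : EuclideanSpace ℝ (Fin d) => ρ ‖s‖ * ‖s‖^2) (Metric.ball 0 1) := by
    by_contra hc
    rw [integral_undef hc] at hρ_mom2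
    have : (0:ℝ) < d := by exact_mod_cast hd
    linarith
  have hinti : ∀ i, IntegrableOn (fun s : EuclideanSpace ℝ (Fin d) => ρ ‖s‖ * (s i * s i)) (Metric.ball 0 1) := by
    intro i
    have := hint.bdd_mul (f := fun s : EuclideanSpace ℝ (Fin d) => (s i)^2 / ‖s‖^2) (c := 1)
      (by apply Measurable.aestronglyMeasurable; fun_prop)
      (by
        filter_upwards with s
        rw [Real.norm_eq_abs, abs_of_nonneg (by positivity)]
        apply div_le_one_of_le₀ _ (by positivity)
        rw [sq_le_sq, abs_norm]
        exact PiLp.norm_apply_le s i)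
    refine this.congr ?_
    filter_upwards with s
    by_cases hs : s = 0
    · simp [hs]
    · have : ‖s‖ ≠ 0 := norm_ne_zero_iff.2 hs
      field_simp
  split_ifs with h
  · subst h
    have heq : ∀ k, ∫ s in Metric.ball (0 : EuclideanSpace ℝ (Fin d)) 1, ρ ‖s‖ * (s k * s k) =
       ∫ s in Metric.ball (0 : EuclideanSpace ℝ (Fin d)) 1, ρ ‖s‖ * (s i * s i) := by
      intro k
      have := inv (LinearIsometryEquiv.piLpCongrLeft 2 ℝ ℝ (Equiv.swap i k)) (fun s => ρ ‖s‖ * (s k * s k))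
      rw [← this]
      simp [LinearIsometryEquiv.piLpCongrLeft_apply, Equiv.piCongrLeft'_apply]
    have hsum : ∑ k, ∫ s in Metric.ball (0 : EuclideanSpace ℝ (Fin d)) 1, ρ ‖s‖ * (s k * s k) = 2 * d := by
      rw [← integral_finsetSum _ (fun k _ => hinti k), ← hρ_mom2]
      congr 1; funext s
      rw [EuclideanSpace.norm_sq_eq, Finset.mul_sum]
      simp [sq]
    rw [Finset.sum_congr rfl (fun k _ => heq k)] at hsum
    simp at hsum
    have : (0:ℝ) < d := by exact_mod_cast hd
    nlinarith
  · set T : EuclideanSpace ℝ (Fin d) ≃ₗᵢ[ℝ] EuclideanSpace ℝ (Fin d) :=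
      LinearIsometryEquiv.piLpCongrRight 2 (fun k => if k = i then LinearIsometryEquiv.neg ℝ else LinearIsometryEquiv.refl ℝ ℝ) with hT
    have h1 := inv T (fun s => ρ ‖s‖ * (s i * s j))
    have h2 : ∀ s : EuclideanSpace ℝ (Fin d), ρ ‖T s‖ * (T s i * T s j) = -(ρ ‖s‖ * (s i * s j)) := by
      intro s
      rw [T.norm_map]
      simp [hT, Ne.symm h]
    simp only [h2, integral_neg] at h1
    linarith

lemma quasiOp_eq {d : ℕ} (ρ : ℝ → ℝ) (B₁ : Finset (EuclideanSpace ℝ (Fin d)))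
    (ω : EuclideanSpace ℝ (Fin d) → ℝ) (δ : ℝ) (hδ : 0 < δ) (u : EuclideanSpace ℝ (Fin d) → ℝ)
    (x : EuclideanSpace ℝ (Fin d)) :
    quasiOp d ρ B₁ ω δ u x = 2 / δ^2 * ∑ s ∈ B₁, ω s * ρ ‖s‖ * (u (x + δ • s) - u x) := by
  unfold quasiOp rhoScaled
  rw [Finset.mul_sum, Finset.mul_sum]
  refine Finset.sum_congr rfl fun s _ => ?_
  rw [mul_div_cancel_left₀ _ hδ.ne', pow_add]
  field_simp

lemma gridPt_apply {d : ℕ} (h : Fin d → ℝ) (k : Fin d → ℤ) (j : Fin d) :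
    gridPt d h k j = k j * h j := rfl

lemma RK_shift {d : ℕ} (h : Fin d → ℝ) (hh : ∀ j, 0 < h j) (c : (Fin d → ℤ) → ℝ)
    (x : EuclideanSpace ℝ (Fin d)) (k : Fin d → ℤ) (y : Fin d → ℝ) (hx : ∀ j, x j / h j = k j + y j)
    (L : ℕ) (hL : ∀ j, |y j| + 2 ≤ L) :
    RKfun d h c x = ∑ n ∈ Fintype.piFinset (fun _ : Fin d => Finset.Icc (-(L:ℤ)) L),
      Phi (fun j => y j - n j) * c (k + n) := by
  unfold RKfun
  rw [← (Equiv.addLeft k).tsum_eq, tsum_eq_sum (s := Fintype.piFinset (fun _ : Fin d => Finset.Icc (-(L:ℤ)) L))]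
  · refine Finset.sum_congr rfl fun n _ => ?_
    rw [Psi_eq h hh]
    simp only [Equiv.coe_addLeft]
    congr 2
    funext j
    rw [hx]; simp
  · intro n hn
    simp only [Fintype.mem_piFinset, not_forall] at hn
    obtain ⟨j, hj⟩ := hn
    rw [Psi_eq h hh, Phi_zero j, zero_mul]
    rw [hx]
    have e : (k j + y j - ((Equiv.addLeft k n) j : ℤ) : ℝ) = y j - n j := by simp
    rw [e]
    by_contra hc
    push Not at hc
    apply hj
    have h1 := hL j
    have h2 := neg_abs_le (y j)
    have h3 := le_abs_self (y j)
    rw [abs_lt] at hc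
    rw [Finset.mem_Icc]
    constructor
    · exact_mod_cast (by linarith : -(L:ℝ) ≤ n j)
    · exact_mod_cast (by linarith : (n j:ℝ) ≤ L)

lemma consist_s {d : ℕ} {u : EuclideanSpace ℝ (Fin d) → ℝ} (hu : ContDiff ℝ 4 u) {M : ℝ} (hM0 : 0 < M)
    (hM : ∀ β : Fin d → ℕ, (∑ j, β j) ≤ 4 → ∀ y, |multiDeriv d β u y| ≤ M)
    (h : Fin d → ℝ) (hh : ∀ j, 0 < h j) (η : ℝ) (hη : ∀ j, h j ≤ η)
    (k : Fin d → ℤ) (v : EuclideanSpace ℝ (Fin d))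
    (L : ℕ) (hL : ∀ j, |v j / h j| + 2 ≤ L) :
    |RKfun d h (fun k => u (gridPt d h k)) (gridPt d h k + v)
      + RKfun d h (fun k => u (gridPt d h k)) (gridPt d h k - v)
      - 2 * RKfun d h (fun k => u (gridPt d h k)) (gridPt d h k)
      - ∑ i, ∑ j, v i * v j * pderiv1 d j (pderiv1 d i u) (gridPt d h k)| ≤ 4 * ((d * L * η)^4 * M) := by
  set x := gridPt d h k with hx
  set y : Fin d → ℝ := fun j => v j / h j with hy
  set Bx := Fintype.piFinset (fun _ : Fin d => Finset.Icc (-(L:ℤ)) L) with hBx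
  set V : (Fin d → ℤ) → ℝ := fun n => u (gridPt d h (k + n)) with hV
  have hL2 : (2:ℝ) ≤ L ∨ d = 0 := by
    rcases Nat.eq_zero_or_pos d with h0 | h0
    · right; exact h0
    · left; have := hL ⟨0, h0⟩; have := abs_nonneg (v ⟨0, h0⟩ / h ⟨0, h0⟩); linarith
  have hmem : ∀ y : Fin d → ℝ, (∀ j, |y j| + 2 ≤ L) → ∀ j, ∀ n : ℤ, |y j - n| < 2 → n ∈ Finset.Icc (-(L:ℤ)) L := by
    intro y hL j n hc
    have h1 := hL j
    have h2 := neg_abs_le (y j)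
    have h3 := le_abs_self (y j)
    rw [abs_lt] at hc
    rw [Finset.mem_Icc]
    constructor
    · exact_mod_cast (by linarith : -(L:ℝ) ≤ n)
    · exact_mod_cast (by linarith : (n:ℝ) ≤ L)
  have hneg : ∀ f : (Fin d → ℤ) → ℝ, ∑ n ∈ Bx, f n = ∑ n ∈ Bx, f (-n) := by
    intro f
    refine Finset.sum_nbij' (fun n => -n) (fun n => -n) ?_ ?_ ?_ ?_ ?_
    · intro n hn
      simp only [hBx, Fintype.mem_piFinset, Finset.mem_Icc, Pi.neg_apply] at hn ⊢
      intro j; have := hn j; omega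
    · intro n hn
      simp only [hBx, Fintype.mem_piFinset, Finset.mem_Icc, Pi.neg_apply] at hn ⊢
      intro j; have := hn j; omega
    · simp
    · simp
    · simp
  have hL0 : ∀ j : Fin d, |(0 : Fin d → ℝ) j| + 2 ≤ L := by
    intro j; have := hL j; have := abs_nonneg (v j / h j); simp only [Pi.zero_apply, abs_zero]; linarith
  have e1 := RK_shift h hh (fun k => u (gridPt d h k)) (x + v) k y
    (fun j => by have := (hh j).ne'; simp only [PiLp.add_apply, hx, gridPt_apply, hy]; field_simp) L hL
  have e2 := RK_shift h hh (fun k => u (gridPt d h k)) (x - v) k (-y)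
    (fun j => by have := (hh j).ne'; simp only [PiLp.sub_apply, hx, gridPt_apply, hy, Pi.neg_apply]; field_simp; ring) L
    (by simpa using hL)
  have e3 := RK_shift h hh (fun k => u (gridPt d h k)) x k 0
    (fun j => by have := (hh j).ne'; simp only [hx, gridPt_apply, Pi.zero_apply]; field_simp; ring) L hL0
  rw [← hBx] at e1 e2 e3
  have e2' : ∑ n ∈ Bx, Phi (fun j => (-y) j - n j) * V n = ∑ n ∈ Bx, Phi (fun j => y j - n j) * V (-n) := by
    rw [hneg]
    refine Finset.sum_congr rfl fun n _ => ?_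
    rw [← Phi_neg]
    congr 2
    funext j; simp; ring
  have e3' : ∑ n ∈ Bx, Phi (fun j => (0 : Fin d → ℝ) j - n j) * V n
      = ∑ n ∈ Bx, Phi (fun j => (0 : Fin d → ℝ) j - n j) * V (-n) := by
    rw [hneg]
    refine Finset.sum_congr rfl fun n _ => ?_
    rw [← Phi_neg]
    congr 2
    funext j; simp
  have m0 := Phi_mom0 y (fun _ => Finset.Icc (-(L:ℤ)) L) (hmem y hL)
  have m0' := Phi_mom0 0 (fun _ => Finset.Icc (-(L:ℤ)) L) (hmem 0 hL0)
  have m2 := Phi_mom2 y (fun _ => Finset.Icc (-(L:ℤ)) L) (hmem y hL)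
  have m2' := Phi_mom2 0 (fun _ => Finset.Icc (-(L:ℤ)) L) (hmem 0 hL0)
  rw [← hBx] at m0 m0' 
  simp only [← hBx] at m2 m2'
  set Q : (Fin d → ℤ) → ℝ := fun n => ∑ i, ∑ j, (h i * n i) * (h j * n j) * pderiv1 d j (pderiv1 d i u) x with hQ
  have hW : ∀ n ∈ Bx, |V n + V (-n) - 2 * u x - Q n| ≤ 2 * ((d * L * η)^4 * M) := by
    intro n hn
    set w : EuclideanSpace ℝ (Fin d) := WithLp.toLp 2 (fun j => h j * n j) with hw
    have := taylor4 hu hM x w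
    have a1 : x + w = gridPt d h (k + n) := by
      ext j; simp [hx, hw, gridPt_apply]; ring
    have a2 : x - w = gridPt d h (k + -n) := by
      ext j; simp [hx, hw, gridPt_apply]; ring
    rw [a1, a2] at this
    refine this.trans ?_
    gcongr
    calc ∑ j, |w j| ≤ ∑ j : Fin d, L * η := by
          apply Finset.sum_le_sum
          intro j _
          show |h j * n j| ≤ _
          rw [abs_mul, abs_of_pos (hh j), mul_comm]
          have : |(n j : ℝ)| ≤ L := by
            have := Fintype.mem_piFinset.1 hn j
            rw [Finset.mem_Icc] at this
            rw [abs_le]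
            constructor
            · exact_mod_cast this.1
            · exact_mod_cast this.2
          exact mul_le_mul this (hη j) (hh j).le (by positivity)
      _ = d * L * η := by simp; ring
  have main : RKfun d h (fun k => u (gridPt d h k)) (x + v)
      + RKfun d h (fun k => u (gridPt d h k)) (x - v)
      - 2 * RKfun d h (fun k => u (gridPt d h k)) x
      - ∑ i, ∑ j, v i * v j * pderiv1 d j (pderiv1 d i u) x =
      ∑ n ∈ Bx, (Phi (fun j => y j - n j) - Phi (fun j => (0 : Fin d → ℝ) j - n j)) * (V n + V (-n) - 2 * u x - Q n) := by
    have q1 : ∑ n ∈ Bx, (Phi (fun j => y j - n j) - Phi (fun j => (0 : Fin d → ℝ) j - n j)) * Q n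
        = ∑ i, ∑ j, v i * v j * pderiv1 d j (pderiv1 d i u) x := by
      simp only [hQ, Finset.mul_sum]
      rw [Finset.sum_comm]
      refine Finset.sum_congr rfl fun i _ => ?_
      rw [Finset.sum_comm]
      refine Finset.sum_congr rfl fun j _ => ?_
      have : ∀ n : Fin d → ℤ, (Phi (fun j => y j - n j) - Phi (fun j => (0 : Fin d → ℝ) j - n j)) *
          ((h i * n i) * (h j * n j) * pderiv1 d j (pderiv1 d i u) x) =
          (h i * h j * pderiv1 d j (pderiv1 d i u) x) * (Phi (fun j => y j - n j) * (n i * n j)) -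
          (h i * h j * pderiv1 d j (pderiv1 d i u) x) * (Phi (fun j => (0 : Fin d → ℝ) j - n j) * (n i * n j)) := by
        intro n; ring
      rw [Finset.sum_congr rfl fun n _ => this n, Finset.sum_sub_distrib, ← Finset.mul_sum, ← Finset.mul_sum,
        m2 i j, m2' i j]
      have h1 := (hh i).ne'
      have h2 := (hh j).ne'
      simp only [hy, Pi.zero_apply]
      field_simp
      ring
    have q2 : ∑ n ∈ Bx, (Phi (fun j => y j - n j) - Phi (fun j => (0 : Fin d → ℝ) j - n j)) * (2 * u x) = 0 := by
      rw [← Finset.sum_mul, Finset.sum_sub_distrib, m0, m0']; ring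
    rw [← q1]
    simp only [mul_sub, Finset.sum_sub_distrib]
    rw [q2]
    simp only [sub_mul, mul_add, Finset.sum_sub_distrib, Finset.sum_add_distrib]
    rw [e1, e2, e3]
    change (∑ n ∈ Bx, Phi (fun j => y j - n j) * V n) + (∑ n ∈ Bx, Phi (fun j => (-y) j - n j) * V n)
      - 2 * (∑ n ∈ Bx, Phi (fun j => (0 : Fin d → ℝ) j - n j) * V n) - _ = _
    rw [e2']
    linarith
  rw [main]
  calc _ ≤ ∑ n ∈ Bx, |(Phi (fun j => y j - n j) - Phi (fun j => (0 : Fin d → ℝ) j - n j)) * (V n + V (-n) - 2 * u x - Q n)| :=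
        Finset.abs_sum_le_sum_abs _ _
    _ ≤ ∑ n ∈ Bx, (Phi (fun j => y j - n j) + Phi (fun j => (0 : Fin d → ℝ) j - n j)) * (2 * ((d * L * η)^4 * M)) := by
      apply Finset.sum_le_sum
      intro n hn
      rw [abs_mul]
      have p1 := Phi_nonneg (fun j => y j - n j)
      have p2 := Phi_nonneg (fun j => (0 : Fin d → ℝ) j - n j)
      apply mul_le_mul _ (hW n hn) (abs_nonneg _) (by linarith)
      rw [abs_le]; constructor <;> linarith
    _ = _ := by
      rw [← Finset.sum_mul, Finset.sum_add_distrib, m0, m0']; ring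

lemma consist {d : ℕ} {M : ℝ} (hM0 : 0 < M) (ρ : ℝ → ℝ) (hρ_nonneg : ∀ r, 0 ≤ ρ r)
    (M₀ : ℝ) (hM₀ : 0 < M₀) (hhat : Fin d → ℝ) (hhat_mem : ∀ j, 0 < hhat j ∧ hhat j ≤ 1)
    (B₁ : Finset (EuclideanSpace ℝ (Fin d))) (hBsym : ∀ s ∈ B₁, -s ∈ B₁)
    (ω : EuclideanSpace ℝ (Fin d) → ℝ)
    (hω_nonneg : ∀ s ∈ B₁, 0 ≤ ω s) (hω_sym : ∀ s ∈ B₁, ω (-s) = ω s)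
    (hc : ∀ i j : Fin d, ∑ s ∈ B₁, ω s * ρ ‖s‖ * (s i * s j) = if i = j then 1 else 0) :
    ∃ C₁ : ℝ, 0 ≤ C₁ ∧ ∀ δ : ℝ, 0 < δ → ∀ u : EuclideanSpace ℝ (Fin d) → ℝ, ContDiff ℝ 4 u →
      (∀ β : Fin d → ℕ, (∑ j, β j) ≤ 4 → ∀ y, |multiDeriv d β u y| ≤ M) → ∀ k,
      |quasiOp d ρ B₁ ω δ (RKfun d (fun j => (δ / M₀) * hhat j)
          (fun k => u (gridPt d (fun j => (δ / M₀) * hhat j) k)))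
          (gridPt d (fun j => (δ / M₀) * hhat j) k)
        - laplacian d u (gridPt d (fun j => (δ / M₀) * hhat j) k)| ≤ C₁ * δ^2 := by
  obtain ⟨L, hL⟩ : ∃ L : ℕ, ∀ s ∈ B₁, ∀ j, |M₀ * s j / hhat j| + 2 ≤ L := by
    obtain ⟨L, hL⟩ := exists_nat_ge (∑ s ∈ B₁, ∑ j, |M₀ * s j / hhat j| + 2)
    refine ⟨L, fun s hs j => ?_⟩
    have h1 := Finset.single_le_sum (f := fun j => |M₀ * s j / hhat j|) (fun j _ => abs_nonneg _) (Finset.mem_univ j)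
    have h2 := Finset.single_le_sum (f := fun s : EuclideanSpace ℝ (Fin d) => ∑ j, |M₀ * s j / hhat j|)
      (fun s _ => Finset.sum_nonneg fun j _ => abs_nonneg _) hs
    simp only at h1 h2
    linarith
  have hw0 : 0 ≤ ∑ s ∈ B₁, ω s * ρ ‖s‖ := Finset.sum_nonneg fun s hs => mul_nonneg (hω_nonneg s hs) (hρ_nonneg _)
  refine ⟨(∑ s ∈ B₁, ω s * ρ ‖s‖) * (4 * ((d * L / M₀)^4 * M)), by positivity, ?_⟩
  intro δ hδ u hu hM k
  set h : Fin d → ℝ := fun j => (δ / M₀) * hhat j with hh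
  have hhpos : ∀ j, 0 < h j := fun j => mul_pos (div_pos hδ hM₀) (hhat_mem j).1
  have hη : ∀ j, h j ≤ δ / M₀ := fun j => by
    have := div_pos hδ hM₀
    have := (hhat_mem j).2
    simp only [hh]; nlinarith
  set x := gridPt d h k with hx
  set R := RKfun d h (fun k => u (gridPt d h k)) with hR
  have hs : ∀ s ∈ B₁, |R (x + δ • s) + R (x + δ • (-s)) - 2 * R x
      - δ^2 * ∑ i, ∑ j, s i * s j * pderiv1 d j (pderiv1 d i u) x| ≤ 4 * ((d * L * (δ / M₀))^4 * M) := by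
    intro s hs
    have := consist_s hu hM0 hM h hhpos (δ / M₀) hη k (δ • s) L (fun j => by
      have e : (δ • s) j / h j = M₀ * s j / hhat j := by
        have h1 := hδ.ne'
        have h2 := hM₀.ne'
        have h3 := (hhat_mem j).1.ne'
        simp only [hh, PiLp.smul_apply, smul_eq_mul]
        field_simp
      rw [e]; exact hL s hs j)
    rw [smul_neg, ← sub_eq_add_neg]
    convert this using 3
    simp only [Finset.mul_sum, PiLp.smul_apply, smul_eq_mul]
    refine Finset.sum_congr rfl fun i _ => Finset.sum_congr rfl fun j _ => ?_
    ring
  have hsym : ∀ f : EuclideanSpace ℝ (Fin d) → ℝ, ∑ s ∈ B₁, ω s * ρ ‖s‖ * f (-s) = ∑ s ∈ B₁, ω s * ρ ‖s‖ * f s := by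
    intro f
    refine Finset.sum_nbij' (fun s => -s) (fun s => -s) hBsym hBsym (by simp) (by simp) ?_
    intro s hs
    rw [hω_sym s hs, norm_neg]
  rw [quasiOp_eq _ _ _ _ hδ]
  have h2 : ∑ s ∈ B₁, ω s * ρ ‖s‖ * (R (x + δ • s) - R x) =
      1/2 * ∑ s ∈ B₁, ω s * ρ ‖s‖ * (R (x + δ • s) + R (x + δ • (-s)) - 2 * R x) := by
    have h3 := hsym (fun s => R (x + δ • s) - R x)
    have h4 : ∑ s ∈ B₁, ω s * ρ ‖s‖ * (R (x + δ • s) + R (x + δ • (-s)) - 2 * R x) =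
      ∑ s ∈ B₁, ω s * ρ ‖s‖ * (R (x + δ • s) - R x) + ∑ s ∈ B₁, ω s * ρ ‖s‖ * (R (x + δ • (-s)) - R x) := by
      rw [← Finset.sum_add_distrib]
      exact Finset.sum_congr rfl fun s _ => by ring
    rw [h4, h3]; ring
  have h5 : laplacian d u x = ∑ s ∈ B₁, ω s * ρ ‖s‖ * ∑ i, ∑ j, s i * s j * pderiv1 d j (pderiv1 d i u) x := by
    simp only [Finset.mul_sum]
    rw [Finset.sum_comm]
    unfold laplacian
    refine Finset.sum_congr rfl fun i _ => ?_
    rw [Finset.sum_comm]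
    have : ∀ j, ∑ s ∈ B₁, ω s * ρ ‖s‖ * (s i * s j * pderiv1 d j (pderiv1 d i u) x) =
        (if i = j then 1 else 0) * pderiv1 d j (pderiv1 d i u) x := by
      intro j
      rw [← hc i j, Finset.sum_mul]
      exact Finset.sum_congr rfl fun s _ => by ring
    rw [Finset.sum_congr rfl fun j _ => this j]
    simp
  have h6 : 2 / δ^2 * ∑ s ∈ B₁, ω s * ρ ‖s‖ * (R (x + δ • s) - R x) - laplacian d u x
      = 1 / δ^2 * ∑ s ∈ B₁, ω s * ρ ‖s‖ * (R (x + δ • s) + R (x + δ • (-s)) - 2 * R x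
      - δ^2 * ∑ i, ∑ j, s i * s j * pderiv1 d j (pderiv1 d i u) x) := by
    rw [h2, h5]
    simp only [mul_sub (_ * _) (_ - _) (δ^2 * _)]
    rw [Finset.sum_sub_distrib]
    simp only [mul_left_comm _ (δ^2) _]
    rw [← Finset.mul_sum]
    have := hδ.ne'
    field_simp
  rw [h6, abs_mul, abs_of_pos (by positivity)]
  calc 1 / δ^2 * |_| ≤ 1 / δ^2 * ∑ s ∈ B₁, ω s * ρ ‖s‖ * (4 * ((d * L * (δ / M₀))^4 * M)) := by
        gcongr
        refine (Finset.abs_sum_le_sum_abs _ _).trans (Finset.sum_le_sum fun s hsB => ?_)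
        have := mul_nonneg (hω_nonneg s hsB) (hρ_nonneg ‖s‖)
        rw [abs_mul, abs_of_nonneg this]
        exact mul_le_mul_of_nonneg_left (hs s hsB) this
    _ = _ := by
      rw [← Finset.sum_mul]
      have := hδ.ne'
      field_simp

lemma sum_rearr {α β : Type*} (B : Finset α) (S : Finset β) (w : α → ℝ) (e P0 : β → ℝ) (P : α → β → ℝ) (c : ℝ) :
    ∑ k ∈ S, e k * (-(c * ∑ s ∈ B, w s * (P s k - P0 k))) =
      c * ∑ s ∈ B, w s * (∑ k ∈ S, e k * P0 k - ∑ k ∈ S, e k * P s k) := by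
  simp only [← Finset.sum_sub_distrib, Finset.mul_sum, ← Finset.sum_neg_distrib]
  rw [Finset.sum_comm]
  exact Finset.sum_congr rfl fun s _ => Finset.sum_congr rfl fun k _ => by ring

lemma stability {d : ℕ} (ρ : ℝ → ℝ) (hρ_nonneg : ∀ r, 0 ≤ ρ r)
    (δ₀ M₀ R : ℝ) (hδ₀ : 0 < δ₀) (hM₀ : 0 < M₀) (hR : 0 < R)
    (hhat : Fin d → ℝ) (hhat_mem : ∀ j, 0 < hhat j ∧ hhat j ≤ 1)
    (B₁ : Finset (EuclideanSpace ℝ (Fin d)))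
    (ω : EuclideanSpace ℝ (Fin d) → ℝ) (hω_nonneg : ∀ s ∈ B₁, 0 ≤ ω s)
    (s₀ : EuclideanSpace ℝ (Fin d)) (hs₀ : s₀ ∈ B₁) (hw : 0 < ω s₀ * ρ ‖s₀‖) (i : Fin d) (hi : s₀ i ≠ 0) :
    ∃ c : ℝ, 0 < c ∧ ∀ δ : ℝ, 0 < δ → δ ≤ δ₀ → ∀ (S : Finset (Fin d → ℤ)) (e : (Fin d → ℤ) → ℝ),
      (∀ k ∈ S, ∀ j, |k j * ((δ / M₀) * hhat j)| ≤ R) → (∀ k, k ∉ S → e k = 0) →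
      c * ∑ k ∈ S, e k ^ 2 ≤ ∑ k ∈ S, e k * (-(quasiOp d ρ B₁ ω δ (RKfun d (fun j => (δ / M₀) * hhat j) e)
        (gridPt d (fun j => (δ / M₀) * hhat j) k))) := by
  have hsi : 0 < |s₀ i| := abs_pos.2 hi
  have hhi := (hhat_mem i).1
  set C₂ := (2 * hhat i * δ₀ / M₀ + 2 * R) / |s₀ i| + δ₀ with hC₂
  have hC₂p : 0 < C₂ := by positivity
  refine ⟨2 * (ω s₀ * ρ ‖s₀‖) / (C₂^2 * 4^d), by positivity, ?_⟩
  intro δ hδ hδ' S e hS he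
  set h : Fin d → ℝ := fun j => (δ / M₀) * hhat j with hh
  have hhpos : ∀ j, 0 < h j := fun j => mul_pos (div_pos hδ hM₀) (hhat_mem j).1
  set Y : EuclideanSpace ℝ (Fin d) → Fin d → ℝ := fun s j => M₀ * s j / hhat j with hY
  have hen : ∑ k ∈ S, e k * (-(quasiOp d ρ B₁ ω δ (RKfun d h e) (gridPt d h k))) =
      2 / δ^2 * ∑ s ∈ B₁, ω s * ρ ‖s‖ * (KK S e 0 - KK S e (Y s)) := by
    have h1 : ∀ k : Fin d → ℤ, RKfun d h e (gridPt d h k) = ∑ m ∈ S, Phi (fun j => k j + (0 : Fin d → ℝ) j - m j) * e m := by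
      intro k
      rw [RK_eq_S h hhpos e S he]
      refine Finset.sum_congr rfl fun m _ => ?_
      congr 2; funext j
      have := (hhpos j).ne'
      rw [gridPt_apply]; simp only [Pi.zero_apply]; field_simp; ring
    have h2 : ∀ (k : Fin d → ℤ) s, RKfun d h e (gridPt d h k + δ • s) = ∑ m ∈ S, Phi (fun j => k j + Y s j - m j) * e m := by
      intro k s
      rw [RK_eq_S h hhpos e S he]
      refine Finset.sum_congr rfl fun m _ => ?_
      congr 2; funext j
      have h1 := hδ.ne'
      have h2 := hM₀.ne'
      have h3 := (hhat_mem j).1.ne'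
      simp only [PiLp.add_apply, PiLp.smul_apply, smul_eq_mul, gridPt_apply, hh, hY]
      field_simp
    simp only [quasiOp_eq ρ B₁ ω δ hδ]
    have h3 : ∀ y, KK S e y = ∑ k ∈ S, e k * ∑ m ∈ S, Phi (fun j => k j + y j - m j) * e m := by
      intro y
      unfold KK
      refine Finset.sum_congr rfl fun k _ => ?_
      rw [Finset.mul_sum]
      exact Finset.sum_congr rfl fun m _ => by ring
    simp only [h1, h2, h3]
    exact sum_rearr B₁ S (fun s => ω s * ρ ‖s‖) e _ (fun s k => ∑ m ∈ S, Phi (fun j => k j + Y s j - m j) * e m) _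
  rw [hen]
  set a := (2 * hhat i / M₀ + 2 * R / δ) / |s₀ i| with ha
  have ha0 : 0 < a := by positivity
  set n := ⌈a⌉₊ with hn
  have hna : a ≤ n := Nat.le_ceil a
  have hnC : (n:ℝ) ≤ C₂ / δ := by
    have h1 : (n:ℝ) < a + 1 := Nat.ceil_lt_add_one ha0.le
    have h2 : a + 1 ≤ C₂ / δ := by
      rw [le_div_iff₀ hδ, ha, hC₂, add_mul, one_mul]
      have h3 : (2 * hhat i / M₀ + 2 * R / δ) / |s₀ i| * δ = (2 * hhat i * δ / M₀ + 2 * R) / |s₀ i| := by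
        field_simp
      rw [h3]
      gcongr
    linarith
  have hK0 : KK S e (fun j => n * Y s₀ j) = 0 := by
    unfold KK
    refine Finset.sum_eq_zero fun k hk => Finset.sum_eq_zero fun m hm => ?_
    rw [Phi_zero i, mul_zero]
    have b1 : ∀ k ∈ S, |(k i : ℝ)| ≤ R * M₀ / (δ * hhat i) := by
      intro k hk
      have := hS k hk i
      rw [abs_mul, abs_of_pos (hhpos i)] at this
      have h5 := hhpos i
      rw [le_div_iff₀ (by positivity)]
      simp only [hh] at this
      have h6 : |(k i:ℝ)| * (δ * hhat i) = |(k i:ℝ)| * (δ / M₀ * hhat i) * M₀ := by field_simp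
      rw [h6]
      gcongr
    have b2 : 2 + 2 * (R * M₀ / (δ * hhat i)) ≤ |n * Y s₀ i| := by
      rw [abs_mul, Nat.abs_cast, hY]
      simp only
      rw [abs_div, abs_mul, abs_of_pos hM₀, abs_of_pos hhi]
      calc 2 + 2 * (R * M₀ / (δ * hhat i)) = a * (M₀ * |s₀ i| / hhat i) := by
            rw [ha]; field_simp
        _ ≤ _ := by gcongr
    have b3 := b1 k hk
    have b4 := b1 m hm
    have b5 : |n * Y s₀ i| ≤ |(k i:ℝ) + n * Y s₀ i - m i| + |(k i:ℝ)| + |(m i:ℝ)| := by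
      have := abs_add_three ((k i:ℝ) + n * Y s₀ i - m i) (-(k i:ℝ)) (m i:ℝ)
      rw [abs_neg] at this
      refine le_trans (le_of_eq ?_) this
      congr 1; ring
    linarith
  have hdiff := KK_diff S e (Y s₀) n
  rw [hK0, sub_zero] at hdiff
  have hlow := KK_lower S e
  have hnn := KK_diff_nonneg S e (Y s₀)
  have hsum : ω s₀ * ρ ‖s₀‖ * (KK S e 0 - KK S e (Y s₀)) ≤ ∑ s ∈ B₁, ω s * ρ ‖s‖ * (KK S e 0 - KK S e (Y s)) :=
    Finset.single_le_sum (f := fun s => ω s * ρ ‖s‖ * (KK S e 0 - KK S e (Y s)))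
      (fun s hs => mul_nonneg (mul_nonneg (hω_nonneg s hs) (hρ_nonneg _)) (KK_diff_nonneg S e _)) hs₀
  have h7 : KK S e 0 ≤ (C₂/δ)^2 * (KK S e 0 - KK S e (Y s₀)) := by
    refine hdiff.trans ?_
    gcongr
  calc _ ≤ 2 * (ω s₀ * ρ ‖s₀‖) / (C₂^2 * 4^d) * (4^d * ((C₂/δ)^2 * (KK S e 0 - KK S e (Y s₀)))) := by
        gcongr
        refine hlow.trans ?_
        gcongr
    _ = 2 / δ^2 * (ω s₀ * ρ ‖s₀‖ * (KK S e 0 - KK S e (Y s₀))) := by field_simp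
    _ ≤ _ := by gcongr

lemma grid_finset {d : ℕ} (Ω : Set (EuclideanSpace ℝ (Fin d))) (R : ℝ) (hR : 0 < R)
    (hΩ : ∀ x ∈ Ω, ‖x‖ ≤ R) (h : Fin d → ℝ) (hh : ∀ j, 0 < h j) :
    ∃ S : Finset (Fin d → ℤ), (∀ k, k ∈ S ↔ gridPt d h k ∈ Ω) ∧ (∀ k ∈ S, ∀ j, |k j * h j| ≤ R) ∧
      (S.card : ℝ) ≤ ∏ j, (2 * R / h j + 1) := by
  classical
  have hb : ∀ k, gridPt d h k ∈ Ω → ∀ j, |k j * h j| ≤ R := by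
    intro k hk j
    have := (PiLp.norm_apply_le (gridPt d h k) j).trans (hΩ _ hk)
    exact this
  set P := Fintype.piFinset (fun j => Finset.Icc (-⌊R / h j⌋) ⌊R / h j⌋) with hP
  refine ⟨P.filter (fun k => gridPt d h k ∈ Ω), ?_, ?_, ?_⟩
  · intro k
    rw [Finset.mem_filter]
    refine ⟨fun h => h.2, fun hk => ⟨?_, hk⟩⟩
    rw [hP, Fintype.mem_piFinset]
    intro j
    have h1 := hb k hk j
    rw [abs_le] at h1
    rw [Finset.mem_Icc, neg_le, Int.le_floor, Int.le_floor, le_div_iff₀ (hh j), le_div_iff₀ (hh j)]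
    push_cast
    constructor <;> linarith [h1.1, h1.2]
  · intro k hk
    exact hb k (Finset.mem_filter.1 hk).2
  · have h1 : ((P.filter (fun k => gridPt d h k ∈ Ω)).card : ℝ) ≤ P.card := by
      exact_mod_cast Finset.card_filter_le _ _
    refine h1.trans ?_
    rw [hP, Fintype.card_piFinset]
    push_cast
    apply Finset.prod_le_prod
    · intro j _; positivity
    · intro j _
      rw [Int.card_Icc]
      have h0 : 0 ≤ ⌊R / h j⌋ := Int.floor_nonneg.2 (div_pos hR (hh j)).le
      have h2 : (((⌊R / h j⌋ + 1 - -⌊R / h j⌋).toNat : ℤ) : ℝ) = 2 * ⌊R / h j⌋ + 1 := by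
        rw [Int.toNat_of_nonneg (by omega)]; push_cast; ring
      have h3 : (((⌊R / h j⌋ + 1 - -⌊R / h j⌋).toNat : ℕ) : ℝ) = 2 * ⌊R / h j⌋ + 1 := by
        rw [← h2]; norm_cast
      rw [h3, mul_div_assoc]
      have := Int.floor_le (R / h j)
      linarith

lemma norm_le_sum_abs {d : ℕ} (v : EuclideanSpace ℝ (Fin d)) : ‖v‖ ≤ ∑ j, |v j| := by
  conv_lhs => rw [← (EuclideanSpace.basisFun (Fin d) ℝ).sum_repr v]
  refine (norm_sum_le _ _).trans (Finset.sum_le_sum fun j _ => ?_)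
  simp [norm_smul]

lemma floor_box (t : ℝ) (n : ℤ) (h : |t - n| < 2) : n ∈ Finset.Icc (⌊t⌋ - 1) (⌊t⌋ + 2) := by
  rw [abs_lt] at h
  have h1 := Int.floor_le t
  have h2 := Int.lt_floor_add_one t
  rw [Finset.mem_Icc]
  constructor
  · have : (⌊t⌋:ℝ) < n + 2 := by linarith
    have : ⌊t⌋ < n + 2 := by exact_mod_cast this
    omega
  · have : (n:ℝ) < ⌊t⌋ + 3 := by linarith
    have : n < ⌊t⌋ + 3 := by exact_mod_cast this
    omega

lemma interp_err {d : ℕ} {u : EuclideanSpace ℝ (Fin d) → ℝ} (hu : ContDiff ℝ 4 u) {M : ℝ} (hM0 : 0 < M)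
    (hM : ∀ β : Fin d → ℕ, (∑ j, β j) ≤ 4 → ∀ y, |multiDeriv d β u y| ≤ M)
    (h : Fin d → ℝ) (hh : ∀ j, 0 < h j) (x : EuclideanSpace ℝ (Fin d)) :
    |u x - RKfun d h (fun k => u (gridPt d h k)) x| ≤ (∑ j, 2 * h j)^2 * M := by
  set t : Fin d → ℝ := fun j => x j / h j with ht
  set Sx : Fin d → Finset ℤ := fun j => Finset.Icc (⌊t j⌋ - 1) (⌊t j⌋ + 2) with hSx
  have hS : ∀ j, ∀ n : ℤ, |t j - n| < 2 → n ∈ Sx j := fun j n hn => floor_box _ _ hn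
  rw [RK_eq_box h hh _ x Sx hS]
  have m0 := Phi_mom0 t Sx hS
  have m1 := Phi_mom1 t Sx hS
  have hv : ∀ k : Fin d → ℤ, ∀ j, (gridPt d h k - x) j = h j * (k j - t j) := by
    intro k j
    have := (hh j).ne'
    simp only [PiLp.sub_apply, gridPt_apply, ht]; field_simp
  have z1 : ∑ k ∈ Fintype.piFinset Sx, Phi (fun j => t j - k j) * ∑ j, (gridPt d h k - x) j * pderiv1 d j u x = 0 := by
    simp only [Finset.mul_sum]
    rw [Finset.sum_comm]
    refine Finset.sum_eq_zero fun j _ => ?_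
    have : ∀ k : Fin d → ℤ, Phi (fun j => t j - k j) * ((gridPt d h k - x) j * pderiv1 d j u x) =
      (h j * pderiv1 d j u x) * (Phi (fun j => t j - k j) * k j) - (h j * pderiv1 d j u x * t j) * Phi (fun j => t j - k j) := by
      intro k; rw [hv]; ring
    rw [Finset.sum_congr rfl fun k _ => this k, Finset.sum_sub_distrib, ← Finset.mul_sum, ← Finset.mul_sum, m0, m1]
    ring
  have main : u x - ∑ k ∈ Fintype.piFinset Sx, Phi (fun j => x j / h j - k j) * u (gridPt d h k) =
      - ∑ k ∈ Fintype.piFinset Sx, Phi (fun j => t j - k j) *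
        (u (x + (gridPt d h k - x)) - u x - ∑ j, (gridPt d h k - x) j * pderiv1 d j u x) := by
    simp only [add_sub_cancel]
    simp only [mul_sub (Phi _), Finset.sum_sub_distrib]
    rw [z1, ← Finset.sum_mul, m0]
    simp only [ht]; ring
  rw [main, abs_neg]
  calc _ ≤ ∑ k ∈ Fintype.piFinset Sx, |Phi (fun j => t j - k j) *
        (u (x + (gridPt d h k - x)) - u x - ∑ j, (gridPt d h k - x) j * pderiv1 d j u x)| := Finset.abs_sum_le_sum_abs _ _
    _ ≤ ∑ k ∈ Fintype.piFinset Sx, Phi (fun j => t j - k j) * ((∑ j, 2 * h j)^2 * M) := by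
      refine Finset.sum_le_sum fun k _ => ?_
      rw [abs_mul, abs_of_nonneg (Phi_nonneg _)]
      by_cases hz : ∃ j, 2 ≤ |t j - k j|
      · obtain ⟨j, hj⟩ := hz
        rw [Phi_zero (t := fun j => t j - k j) j hj]; simp
      · push Not at hz
        refine mul_le_mul_of_nonneg_left ?_ (Phi_nonneg _)
        refine (taylor2 hu hM x _).trans ?_
        have : ∑ j, |(gridPt d h k - x) j| ≤ ∑ j, 2 * h j := by
          refine Finset.sum_le_sum fun j _ => ?_
          rw [hv, abs_mul, abs_of_pos (hh j), abs_sub_comm]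
          have := hz j
          have := hh j
          nlinarith
        gcongr
    _ = _ := by rw [← Finset.sum_mul, m0, one_mul]

lemma RK_sq {d : ℕ} (h : Fin d → ℝ) (hh : ∀ j, 0 < h j) (S : Finset (Fin d → ℤ)) (e : (Fin d → ℤ) → ℝ)
    (he : ∀ k, k ∉ S → e k = 0) (r : ℝ) (hr : ∑ j, 2 * h j ≤ r) (x : EuclideanSpace ℝ (Fin d)) :
    (RKfun d h e x)^2 ≤ ∑ k ∈ S, (Metric.closedBall (gridPt d h k) r).indicator (fun _ => e k ^ 2) x := by
  rw [RK_eq_S h hh e S he]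
  set t : Fin d → ℝ := fun j => x j / h j with ht
  set p : (Fin d → ℤ) → ℝ := fun k => Phi (fun j => t j - k j) with hp
  have hp0 : ∀ k, 0 ≤ p k := fun k => Phi_nonneg _
  have hps : ∑ k ∈ S, p k ≤ 1 := by
    classical
    have m0 := Phi_mom0 t (fun j => Finset.Icc (⌊t j⌋ - 1) (⌊t j⌋ + 2)) (fun j n hn => floor_box _ _ hn)
    rw [← m0]
    refine (Finset.sum_le_sum_of_subset_of_nonneg (Finset.subset_union_left (s₂ := Fintype.piFinset fun j => Finset.Icc (⌊t j⌋ - 1) (⌊t j⌋ + 2))) (fun k _ _ => hp0 k)).trans (le_of_eq ?_)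
    symm
    apply Finset.sum_subset Finset.subset_union_right
    intro k _ hk
    simp only [Fintype.mem_piFinset, not_forall] at hk
    obtain ⟨j, hj⟩ := hk
    apply Phi_zero j
    by_contra hc
    exact hj (floor_box _ _ (not_le.1 hc))
  have cs : (∑ k ∈ S, p k * e k)^2 ≤ (∑ k ∈ S, p k) * ∑ k ∈ S, p k * e k^2 := by
    apply Finset.sum_sq_le_sum_mul_sum_of_sq_le_mul
    · intro k _; exact hp0 k
    · intro k _; exact mul_nonneg (hp0 k) (sq_nonneg _)
    · intro k _; exact le_of_eq (by ring)
  have hn : 0 ≤ ∑ k ∈ S, p k * e k^2 := Finset.sum_nonneg fun k _ => mul_nonneg (hp0 k) (sq_nonneg _)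
  refine cs.trans ((mul_le_of_le_one_left hn hps).trans (Finset.sum_le_sum fun k _ => ?_))
  by_cases hx : x ∈ Metric.closedBall (gridPt d h k) r
  · rw [Set.indicator_of_mem hx]
    exact mul_le_of_le_one_left (sq_nonneg _) (Phi_le_one _)
  · rw [Set.indicator_of_notMem hx]
    have : p k = 0 := by
      by_contra hc
      apply hx
      have hz : ∀ j, |t j - k j| < 2 := by
        intro j
        by_contra hj
        exact hc (Phi_zero j (not_lt.1 hj))
      rw [Metric.mem_closedBall, dist_eq_norm]
      refine (norm_le_sum_abs _).trans (le_trans (Finset.sum_le_sum fun j _ => ?_) hr)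
      have e : (x - gridPt d h k) j = h j * (t j - k j) := by
        have := (hh j).ne'
        simp only [PiLp.sub_apply, gridPt_apply, ht]; field_simp
      rw [e, abs_mul, abs_of_pos (hh j)]
      have := hz j
      have := hh j
      nlinarith
    rw [this, zero_mul]

lemma L2_bound {d : ℕ} (Ω : Set (EuclideanSpace ℝ (Fin d))) (hΩb : Bornology.IsBounded Ω)
    (hΩo : IsOpen Ω)
    (h : Fin d → ℝ) (S : Finset (Fin d → ℤ)) (e : (Fin d → ℤ) → ℝ)
    (r A : ℝ) (hr0 : 0 ≤ r) (F : EuclideanSpace ℝ (Fin d) → ℝ)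
    (hF : ∀ x, (F x)^2 ≤ 2 * A^2 + 2 * ∑ k ∈ S, (Metric.closedBall (gridPt d h k) r).indicator (fun _ => e k ^ 2) x) :
    ∫ x in Ω, (F x)^2 ≤ 2 * A^2 * volume.real Ω + 2 * (r^d * volume.real (Metric.ball (0 : EuclideanSpace ℝ (Fin d)) 1)) * ∑ k ∈ S, e k^2 := by
  have hfin : volume Ω < ⊤ := hΩb.measure_lt_top
  have i1 : IntegrableOn (fun _ : EuclideanSpace ℝ (Fin d) => 2 * A^2) Ω := integrableOn_const hfin.ne
  have i2 : ∀ k ∈ S, Integrable (fun x => (Metric.closedBall (gridPt d h k) r).indicator (fun _ => e k ^ 2) x) := by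
    intro k _
    rw [integrable_indicator_iff Metric.isClosed_closedBall.measurableSet]
    exact integrableOn_const measure_closedBall_lt_top.ne
  have i3 : Integrable (fun x => 2 * ∑ k ∈ S, (Metric.closedBall (gridPt d h k) r).indicator (fun _ => e k ^ 2) x) :=
    (integrable_finsetSum _ i2).const_mul 2
  calc ∫ x in Ω, (F x)^2 ≤ ∫ x in Ω, (2 * A^2 + 2 * ∑ k ∈ S, (Metric.closedBall (gridPt d h k) r).indicator (fun _ => e k ^ 2) x) := by
        apply integral_mono_of_nonneg
        · filter_upwards with x; exact sq_nonneg _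
        · exact i1.add i3.integrableOn
        · filter_upwards with x; exact hF x
    _ = 2 * A^2 * volume.real Ω + ∫ x in Ω, 2 * ∑ k ∈ S, (Metric.closedBall (gridPt d h k) r).indicator (fun _ => e k ^ 2) x := by
        rw [integral_add i1 i3.integrableOn]
        simp; ring
    _ ≤ 2 * A^2 * volume.real Ω + ∫ x, 2 * ∑ k ∈ S, (Metric.closedBall (gridPt d h k) r).indicator (fun _ => e k ^ 2) x := by
        refine add_le_add le_rfl (setIntegral_le_integral i3 ?_)
        filter_upwards with x
        refine mul_nonneg zero_le_two (Finset.sum_nonneg fun k _ => Set.indicator_nonneg (fun _ _ => sq_nonneg _) _)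
    _ = _ := by
        rw [integral_const_mul, integral_finsetSum _ i2, mul_assoc 2 (r^d * _)]
        congr 2
        rw [Finset.mul_sum]
        refine Finset.sum_congr rfl fun k _ => ?_
        rw [integral_indicator Metric.isClosed_closedBall.measurableSet]
        simp only [setIntegral_const, smul_eq_mul]
        rw [Measure.addHaar_real_closedBall _ _ hr0]
        simp

set_option maxHeartbeats 1000000 in
/-- convergence of RK collocation with meshfree integration to the local
limit, along `h = (δ/M₀)ĥ`, `δ → 0`. -/
theorem rk_collocation_meshfree_convergence_local (d : ℕ) (hd : 1 ≤ d) (ρ : ℝ → ℝ)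
    (hρ_nonneg : ∀ r, 0 ≤ ρ r)
    (hρ_mono : ∀ r₁ r₂, 0 ≤ r₁ → r₁ ≤ r₂ → ρ r₂ ≤ ρ r₁)
    (hρ_supp : ∀ r, 1 < r → ρ r = 0)
    (hρ_mom2 : ∫ s in Metric.ball (0 : EuclideanSpace ℝ (Fin d)) 1,
        ρ ‖s‖ * ‖s‖^2 = 2 * d)
    (Ω : Set (EuclideanSpace ℝ (Fin d))) (hΩo : IsOpen Ω)
    (hΩb : Bornology.IsBounded Ω) (hΩc : IsConnected Ω)
    (δ₀ M₀ M : ℝ) (hδ₀ : 0 < δ₀) (hM₀ : 0 < M₀) (hM : 0 < M)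
    (hhat : Fin d → ℝ) (hhat_mem : ∀ j, 0 < hhat j ∧ hhat j ≤ 1)
    (hhat_max : ∃ j, hhat j = 1)
    (B₁ : Finset (EuclideanSpace ℝ (Fin d)))
    (hB : ∀ s ∈ B₁, ‖s‖ ≤ 1 ∧ s ≠ 0) (hBsym : ∀ s ∈ B₁, -s ∈ B₁)
    (ω : EuclideanSpace ℝ (Fin d) → ℝ)
    (hω_nonneg : ∀ s ∈ B₁, 0 ≤ ω s) (hω_sym : ∀ s ∈ B₁, ω (-s) = ω s)
    (ha : ∀ ξ : EuclideanSpace ℝ (Fin d), ξ ≠ 0 →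
      ∃ s ∈ B₁, 0 < ω s * ρ ‖s‖ ∧ (∑ j, s j * ξ j) ≠ 0)
    (hb : ∀ ξ : Fin d → ℝ, (∀ j, ξ j ∈ Set.Icc (-π) π) → ξ ≠ 0 →
      0 < ∑ s ∈ B₁, ω s * ρ ‖s‖ *
            (1 - Real.cos (M₀ * ∑ j, s j * (ξ j / hhat j))))
    (hc : ∀ i j : Fin d,
      2 * ∑ s ∈ B₁, ω s * ρ ‖s‖ * (s i * s j) =
        ∫ s in Metric.ball (0 : EuclideanSpace ℝ (Fin d)) 1, ρ ‖s‖ * (s i * s j)) :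
    ∃ C : ℝ, 0 < C ∧ ∀ δ : ℝ, 0 < δ → δ ≤ δ₀ →
      ∀ u0 : EuclideanSpace ℝ (Fin d) → ℝ, ContDiff ℝ 4 u0 →
      (∀ x, x ∉ Ω → u0 x = 0) →
      (∀ β : Fin d → ℕ, (∑ j, β j) ≤ 4 → ∀ y, |multiDeriv d β u0 y| ≤ M) →
      ∀ fδ : EuclideanSpace ℝ (Fin d) → ℝ,
        (∀ x ∈ Ω, |fδ x - (-(laplacian d u0 x))| ≤ M * δ^2) →
      ∀ c : (Fin d → ℤ) → ℝ,
        (∀ k, gridPt d (fun j => (δ / M₀) * hhat j) k ∉ Ω → c k = 0) →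
        (∀ k, gridPt d (fun j => (δ / M₀) * hhat j) k ∈ Ω →
          -(quasiOp d ρ B₁ ω δ (RKfun d (fun j => (δ / M₀) * hhat j) c)
              (gridPt d (fun j => (δ / M₀) * hhat j) k)) =
            fδ (gridPt d (fun j => (δ / M₀) * hhat j) k)) →
        Real.sqrt (∫ x in Ω,
            (u0 x - RKfun d (fun j => (δ / M₀) * hhat j) c x)^2) ≤
          C * ((δ / M₀)^2 + δ^2) := by
  obtain ⟨R, hR, hΩR⟩ : ∃ R : ℝ, 0 < R ∧ ∀ x ∈ Ω, ‖x‖ ≤ R := by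
    obtain ⟨R, h1, h2⟩ := hΩb.exists_pos_norm_le
    exact ⟨R, h1, h2⟩
  have hc' : ∀ i j : Fin d, ∑ s ∈ B₁, ω s * ρ ‖s‖ * (s i * s j) = if i = j then 1 else 0 := by
    intro i j
    have h1 := hc i j
    rw [isotropy d hd ρ hρ_mom2 i j] at h1
    split_ifs at h1 ⊢ <;> linarith
  obtain ⟨C₁, hC₁, hcons⟩ := consist hM ρ hρ_nonneg M₀ hM₀ hhat hhat_mem B₁ hBsym ω hω_nonneg hω_sym hc'
  set i₀ : Fin d := ⟨0, hd⟩ with hi₀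
  obtain ⟨s₀, hs₀, hw, hs⟩ := ha (EuclideanSpace.single i₀ 1) (by
    intro h0
    have := congrArg (fun v : EuclideanSpace ℝ (Fin d) => v i₀) h0
    simp at this)
  have hsi : s₀ i₀ ≠ 0 := by
    simpa [Pi.single_apply] using hs
  obtain ⟨c', hc'0, hstab⟩ := stability ρ hρ_nonneg δ₀ M₀ R hδ₀ hM₀ hR hhat hhat_mem B₁ ω hω_nonneg s₀ hs₀ hw i₀ hsi
  set Q : ℝ := ∏ j, (2 * R * M₀ / hhat j + δ₀) with hQ
  have hQ0 : 0 ≤ Q := Finset.prod_nonneg fun j _ => by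
    have := (hhat_mem j).1
    positivity
  set V₁ : ℝ := volume.real (Metric.ball (0 : EuclideanSpace ℝ (Fin d)) 1) with hV₁
  have hV₁0 : 0 ≤ V₁ := measureReal_nonneg
  set V : ℝ := volume.real Ω with hV
  have hV0 : 0 ≤ V := measureReal_nonneg
  set C₃ : ℝ := 2 * ((2 * d / M₀)^2 * M)^2 * V + 2 * ((2 * d / M₀)^d * V₁) * (((M + C₁) / c')^2 * Q) with hC₃
  have hC₃0 : 0 ≤ C₃ := by positivity
  refine ⟨Real.sqrt C₃ + 1, by positivity, ?_⟩
  intro δ hδ hδ' u0 hu hu0 hub fδ hf c hcS hcol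
  have hhpos : ∀ j, 0 < (fun j => (δ / M₀) * hhat j) j := fun j => mul_pos (div_pos hδ hM₀) (hhat_mem j).1
  obtain ⟨S, hS, hSb, hcard⟩ := grid_finset Ω R hR hΩR (fun j => (δ / M₀) * hhat j) hhpos
  have hcons' := hcons δ hδ u0 hu hub
  have hst := hstab δ hδ hδ' S
  have hsum : ∑ j, 2 * (fun j => (δ / M₀) * hhat j) j ≤ 2 * d / M₀ * δ := by
    calc ∑ j, 2 * (fun j => (δ / M₀) * hhat j) j ≤ ∑ j : Fin d, 2 * (δ / M₀) := by
          refine Finset.sum_le_sum fun j _ => ?_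
          have h1 := (hhat_mem j).2
          have h2 : 0 < δ / M₀ := by positivity
          show 2 * ((δ / M₀) * hhat j) ≤ _
          nlinarith
      _ = _ := by simp; ring
  have hsum0 : 0 ≤ ∑ j, 2 * (fun j => (δ / M₀) * hhat j) j :=
    Finset.sum_nonneg fun j _ => mul_nonneg zero_le_two (hhpos j).le
  have hie : ∀ x, |u0 x - RKfun d (fun j => (δ / M₀) * hhat j) (fun k => u0 (gridPt d (fun j => (δ / M₀) * hhat j) k)) x| ≤ (2 * d / M₀ * δ)^2 * M := by
    intro x
    refine (interp_err hu hM hub (fun j => (δ / M₀) * hhat j) hhpos x).trans ?_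
    exact mul_le_mul_of_nonneg_right (pow_le_pow_left₀ hsum0 hsum 2) hM.le
  have hcard' : (S.card : ℝ) * δ^d ≤ Q := by
    have h1 : δ^d = ∏ j : Fin d, δ := by simp
    calc (S.card : ℝ) * δ^d ≤ (∏ j, (2 * R / ((δ / M₀) * hhat j) + 1)) * δ^d := by gcongr
      _ = ∏ j, (2 * R * M₀ / hhat j + δ) := by
          rw [h1, ← Finset.prod_mul_distrib]
          refine Finset.prod_congr rfl fun j _ => ?_
          have := (hhat_mem j).1
          field_simp
      _ ≤ Q := by
          refine Finset.prod_le_prod (fun j _ => ?_) (fun j _ => ?_)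
          · have := (hhat_mem j).1
            positivity
          · gcongr
  generalize (fun j => (δ / M₀) * hhat j) = h at *
  set a : (Fin d → ℤ) → ℝ := fun k => u0 (gridPt d h k) with haa
  have haS : ∀ k, k ∉ S → a k = 0 := fun k hk => hu0 _ (fun hx => hk ((hS k).2 hx))
  have hcS' : ∀ k, k ∉ S → c k = 0 := fun k hk => hcS _ (fun hx => hk ((hS k).2 hx))
  set e : (Fin d → ℤ) → ℝ := fun k => c k - a k with he
  have heS : ∀ k, k ∉ S → e k = 0 := fun k hk => by
    simp only [he]; rw [haS k hk, hcS' k hk, sub_zero]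
  have hRK : ∀ x, RKfun d h e x = RKfun d h c x - RKfun d h a x := by
    intro x
    rw [RK_eq_S h hhpos e S heS, RK_eq_S h hhpos c S hcS', RK_eq_S h hhpos a S haS, ← Finset.sum_sub_distrib]
    exact Finset.sum_congr rfl fun k _ => by simp only [he]; ring
  have hq : ∀ x, quasiOp d ρ B₁ ω δ (RKfun d h e) x = quasiOp d ρ B₁ ω δ (RKfun d h c) x - quasiOp d ρ B₁ ω δ (RKfun d h a) x := by
    intro x
    unfold quasiOp
    rw [← mul_sub, ← Finset.sum_sub_distrib]
    congr 1
    refine Finset.sum_congr rfl fun s _ => ?_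
    rw [hRK, hRK]; ring
  have hres : ∀ k ∈ S, |quasiOp d ρ B₁ ω δ (RKfun d h e) (gridPt d h k)| ≤ (M + C₁) * δ^2 := by
    intro k hk
    have hkΩ := (hS k).1 hk
    have h1 := hf _ hkΩ
    have h2 := hcons' k
    have h3 := hcol k hkΩ
    rw [hq]
    rw [abs_le] at h1 h2 ⊢
    constructor <;> linarith [h1.1, h1.2, h2.1, h2.2]
  have hst' := hst e hSb heS
  set E : ℝ := ∑ k ∈ S, e k ^ 2 with hE
  have hE0 : 0 ≤ E := Finset.sum_nonneg fun k _ => sq_nonneg _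
  have hEb : E * δ^d ≤ ((M + C₁) / c')^2 * Q * δ^4 := by
    have h1 : c' * E ≤ ((M + C₁) * δ^2) * ∑ k ∈ S, |e k| := by
      refine hst'.trans ?_
      rw [Finset.mul_sum]
      refine Finset.sum_le_sum fun k hk => ?_
      refine (le_abs_self _).trans ?_
      rw [abs_mul, abs_neg, mul_comm]
      exact mul_le_mul_of_nonneg_right (hres k hk) (abs_nonneg _)
    have h2 : (∑ k ∈ S, |e k|)^2 ≤ S.card * E := by
      have := sq_sum_le_card_mul_sum_sq (s := S) (f := fun k => |e k|)
      simpa only [sq_abs] using this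
    have h3 : (c' * E)^2 ≤ ((M + C₁) * δ^2)^2 * (S.card * E) := by
      calc (c' * E)^2 ≤ (((M + C₁) * δ^2) * ∑ k ∈ S, |e k|)^2 := by gcongr
        _ = ((M + C₁) * δ^2)^2 * (∑ k ∈ S, |e k|)^2 := by ring
        _ ≤ _ := by gcongr
    have h4 : E ≤ ((M + C₁) / c')^2 * δ^4 * S.card := by
      rcases hE0.eq_or_lt with h0 | h0
      · rw [← h0]; positivity
      · have h5 : E * (c'^2 * E) ≤ (((M + C₁) / c')^2 * δ^4 * S.card) * (c'^2 * E) := by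
          calc E * (c'^2 * E) = (c' * E)^2 := by ring
            _ ≤ _ := h3
            _ = _ := by field_simp
        exact le_of_mul_le_mul_right h5 (by positivity)
    calc E * δ^d ≤ (((M + C₁) / c')^2 * δ^4 * S.card) * δ^d := by gcongr
      _ = ((M + C₁) / c')^2 * δ^4 * (S.card * δ^d) := by ring
      _ ≤ ((M + C₁) / c')^2 * δ^4 * Q := by gcongr
      _ = _ := by ring
  have hL2 := L2_bound Ω hΩb hΩo h S e (2 * d / M₀ * δ) ((2 * d / M₀ * δ)^2 * M) (by positivity)
    (fun x => u0 x - RKfun d h c x) (by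
      intro x
      have h1 := hie x
      have h2 := RK_sq h hhpos S e heS _ hsum x
      have h3 : (u0 x - RKfun d h a x)^2 ≤ ((2 * d / M₀ * δ)^2 * M)^2 := by
        rw [sq_le_sq]
        exact h1.trans (le_abs_self _)
      have h4 : u0 x - RKfun d h c x = (u0 x - RKfun d h a x) - RKfun d h e x := by rw [hRK]; ring
      simp only [h4]
      nlinarith [sq_nonneg ((u0 x - RKfun d h a x) + RKfun d h e x)])
  have hfin : ∫ x in Ω, (u0 x - RKfun d h c x)^2 ≤ C₃ * (δ^2)^2 := by
    refine hL2.trans ?_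
    have h1 : 2 * ((2 * d / M₀ * δ)^d * V₁) * E = 2 * ((2 * d / M₀)^d * V₁) * (E * δ^d) := by
      rw [mul_pow]; ring
    rw [h1]
    have h2 : 2 * ((2 * d / M₀)^d * V₁) * (E * δ^d) ≤ 2 * ((2 * d / M₀)^d * V₁) * (((M + C₁) / c')^2 * Q * δ^4) := by
      gcongr
    refine (add_le_add le_rfl h2).trans (le_of_eq ?_)
    rw [hC₃]; ring
  calc Real.sqrt (∫ x in Ω, (u0 x - RKfun d h c x)^2) ≤ Real.sqrt (C₃ * (δ^2)^2) := Real.sqrt_le_sqrt hfin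
    _ = Real.sqrt C₃ * δ^2 := by rw [Real.sqrt_mul hC₃0, Real.sqrt_sq (by positivity)]
    _ ≤ (Real.sqrt C₃ + 1) * ((δ / M₀)^2 + δ^2) := by
        gcongr
        · linarith
        · have : 0 ≤ (δ / M₀)^2 := by positivity
          linarith

end
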